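/- arXiv:2007.08147 — 11 statements merged into one kernel-verified Lean document; each statement's English description precedes it below -/
import Mathlib

section
/- Let X ⊆ ℕ be an ultimately periodic set with period π_X and preperiod a_X. If i, j ≥ a_X and i ≢ j (mod π_X), then there exists r < π_X such that exactly one of the two memberships i + r ∈ X and j + r ∈ X holds. -/
/-- `p` is a period of `X` from index `a` on. -/
def PeriodFrom (X : Set ℕ) (a p : ℕ) : Prop := ∀ n, a ≤ n → (n ∈ X ↔ n + p ∈ X)

/-- `X` is ultimately periodic with (minimal) period `p`. -/
def HasMinPeriod (X : Set ℕ) (p : ℕ) : Prop :=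
  1 ≤ p ∧ (∃ a, PeriodFrom X a p) ∧ ∀ q, 1 ≤ q → (∃ a, PeriodFrom X a q) → p ≤ q

theorem PeriodFrom.mem_iff_add_mul {X : Set ℕ} {a p n : ℕ} (h : PeriodFrom X a p)
    (hn : a ≤ n) (k : ℕ) : n ∈ X ↔ n + p * k ∈ X := by
  induction k with
  | zero => simp
  | succ k ih =>
    rw [ih, h (n + p * k) (by omega), Nat.mul_succ, ← Nat.add_assoc]

/-- If the windows of length `p` starting at `i` and `i + d` agree, then `d` is a period. -/
theorem PeriodFrom.of_window {X : Set ℕ} {a p i d : ℕ} (h : PeriodFrom X a p) (hp : 1 ≤ p)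
    (hi : a ≤ i) (hw : ∀ r < p, (i + r ∈ X ↔ i + d + r ∈ X)) : PeriodFrom X i d := by
  intro n hn
  have hmod := Nat.mod_add_div (n - i) p
  have h₁ := h.mem_iff_add_mul (n := i + (n - i) % p) (by omega) ((n - i) / p)
  have h₂ := h.mem_iff_add_mul (n := i + d + (n - i) % p) (by omega) ((n - i) / p)
  rw [show i + (n - i) % p + p * ((n - i) / p) = n by omega] at h₁
  rw [show i + d + (n - i) % p + p * ((n - i) / p) = n + d by omega] at h₂
  rw [← h₁, ← h₂]
  exact hw _ (Nat.mod_lt _ hp)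

theorem PeriodFrom.mod {X : Set ℕ} {a b p d : ℕ} (hp : PeriodFrom X a p)
    (hd : PeriodFrom X b d) (hab : a ≤ b) : PeriodFrom X b (d % p) := by
  intro n hn
  rw [hd n hn, hp.mem_iff_add_mul (n := n + d % p) (by omega) (d / p), Nat.add_assoc n,
    Nat.mod_add_div]

theorem HasMinPeriod.dvd {X : Set ℕ} {a b p d : ℕ} (hmin : HasMinPeriod X p)
    (hp : PeriodFrom X a p) (hd : PeriodFrom X b d) (hab : a ≤ b) : p ∣ d := by
  by_contra hdvd
  have hpos : 1 ≤ d % p := Nat.emod_pos_of_not_dvd hdvd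
  exact absurd (hmin.2.2 _ hpos ⟨b, hp.mod hd hab⟩) (Nat.mod_lt d hmin.1).not_ge

theorem HasMinPeriod.modEq_of_window {X : Set ℕ} {a p i j : ℕ} (hmin : HasMinPeriod X p)
    (hp : PeriodFrom X a p) (hi : a ≤ i) (hij : i ≤ j)
    (hw : ∀ r < p, (i + r ∈ X ↔ j + r ∈ X)) : i ≡ j [MOD p] := by
  obtain ⟨d, rfl⟩ := Nat.exists_eq_add_of_le hij
  refine (Nat.modEq_iff_dvd' hij).2 ?_
  rw [Nat.add_sub_cancel_left]
  exact hmin.dvd hp (hp.of_window hmin.1 hi hw) hi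

/-- If `X ⊆ ℕ` is ultimately periodic with (minimal) period `πX` and
(minimal) preperiod `aX`, and `i, j ≥ aX` with `i ≢ j (mod πX)`, then there is `r < πX`
such that exactly one of `i + r ∈ X`, `j + r ∈ X` holds. -/
theorem stmt0 (X : Set ℕ) (πX aX : ℕ)
    (hmin : HasMinPeriod X πX)
    (hper : PeriodFrom X aX πX)
    (haX : ∀ b, PeriodFrom X b πX → aX ≤ b)
    (i j : ℕ) (hi : aX ≤ i) (hj : aX ≤ j) (hij : ¬ i ≡ j [MOD πX]) :
    ∃ r < πX, Xor' (i + r ∈ X) (j + r ∈ X) := by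
  by_contra! hw
  replace hw : ∀ r < πX, (i + r ∈ X ↔ j + r ∈ X) := fun r hr =>
    not_xor _ _ |>.1 (hw r hr)
  apply hij
  rcases le_total i j with h | h
  · exact hmin.modEq_of_window hper hi h hw
  · exact (hmin.modEq_of_window hper hj h fun r hr => (hw r hr).symm).symm
end

section
/- Let U be a numeration system with limsup_{i→∞}(U_{i+1} − U_i) = +∞, and suppose the language rep_U(ℕ) of all greedy U-representations is accepted by a deterministic finite automaton with C states. Then for every greedy U-representation w there exists ℓ < C such that 10^ℓ w is also a greedy U-representation. -/
/-- `w` is a greedy `U`-representation: its leading (most significant) digit is nonzero and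
for every `t < |w|`, the value of its last `t+1` digits is `< U (t+1)`.
The empty word is the greedy representation of `0`. -/
def IsGreedyRep (U : ℕ → ℕ) (w : List ℕ) : Prop :=
  w.head? ≠ some 0 ∧
    ∀ t < w.length, ∑ i ∈ Finset.range (t + 1), w.reverse.getD i 0 * U i < U (t + 1)

/-- `U` is a numeration system: an increasing sequence of positive integers with `U 0 = 1`
whose consecutive ratios (rounded up) are bounded. -/
structure IsNumSys (U : ℕ → ℕ) : Prop where
  mono : StrictMono U
  base : U 0 = 1
  ratio : ∃ C : ℕ, ∀ i, U (i + 1) ≤ C * U i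

/-- (H2): `limsup (U (i+1) - U i) = +∞`. -/
def GapsUnbounded (U : ℕ → ℕ) : Prop :=
  ∀ B : ℕ, ∃ᶠ i in Filter.atTop, B ≤ U (i + 1) - U i

theorem getD_reverse_one_zeros (w : List ℕ) (l i : ℕ) :
    (1 :: (List.replicate l 0 ++ w)).reverse.getD i 0 =
      w.reverse.getD i 0 + if i = w.length + l then 1 else 0 := by
  simp only [List.reverse_cons, List.reverse_append, List.reverse_replicate,
    List.getD_eq_getElem?_getD, List.getElem?_append, List.length_append, List.length_reverse,
    List.length_replicate, List.getElem?_replicate]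
  rcases lt_trichotomy i (w.length + l) with h | h | h
  · by_cases h' : i < w.length
    · simp [h, h', h.ne]
    · have h'' : i - w.length < l := by omega
      simp [h, h', h'', h.ne]
  · subst h
    simp
  · have h₁ : ¬ i < w.length + l := by omega
    have h₂ : i - (w.length + l) ≠ 0 := by omega
    simp [h₁, h.ne', List.getElem?_eq_none (l := w.reverse) (i := i) (by simp; omega),
      h₂]

theorem getD_reverse_of_length_le (w : List ℕ) {i : ℕ} (h : w.length ≤ i) :
    w.reverse.getD i 0 = 0 :=
  List.getD_eq_default _ _ (by simpa using h)

/-- Padding a greedy representation with leading zeros keeps the greedy inequalities. -/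
theorem IsGreedyRep.sum_lt {U : ℕ → ℕ} (hU : IsNumSys U) {w : List ℕ} (hw : IsGreedyRep U w)
    (t : ℕ) : ∑ i ∈ Finset.range t, w.reverse.getD i 0 * U i < U t := by
  induction t with
  | zero => simp [hU.base]
  | succ t ih =>
    by_cases h : t < w.length
    · exact hw.2 t h
    · rw [Finset.sum_range_succ, getD_reverse_of_length_le w (not_lt.mp h), zero_mul, add_zero]
      exact ih.trans (hU.mono t.lt_succ_self)

theorem sum_getD_reverse_of_length_le (U : ℕ → ℕ) (w : List ℕ) {k : ℕ} (h : w.length ≤ k) :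
    ∑ i ∈ Finset.range k, w.reverse.getD i 0 * U i =
      ∑ i ∈ Finset.range w.length, w.reverse.getD i 0 * U i := by
  refine (Finset.sum_subset (Finset.range_subset_range.mpr h) fun i _ hi => ?_).symm
  rw [getD_reverse_of_length_le w (by simpa using hi), zero_mul]

theorem IsGreedyRep.exists_one_zeros {U : ℕ → ℕ} (hU : IsNumSys U) (h2 : GapsUnbounded U)
    {w : List ℕ} (hw : IsGreedyRep U w) :
    ∃ l, IsGreedyRep U (1 :: (List.replicate l 0 ++ w)) := by
  obtain ⟨k, hk, hgap⟩ := Filter.frequently_atTop.mp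
    (h2 (∑ i ∈ Finset.range w.length, w.reverse.getD i 0 * U i + 1)) w.length
  obtain ⟨l, rfl⟩ := Nat.exists_eq_add_of_le hk
  refine ⟨l, by simp, fun t ht => ?_⟩
  simp only [List.length_cons, List.length_append, List.length_replicate] at ht
  simp only [getD_reverse_one_zeros, add_mul, Finset.sum_add_distrib, ite_mul, one_mul, zero_mul,
    Finset.sum_ite_eq', Finset.mem_range]
  split_ifs with h
  · obtain rfl : t = w.length + l := by omega
    rw [sum_getD_reverse_of_length_le U w (by omega)]
    omega
  · simpa using hw.sum_lt hU (t + 1)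

/-- Pumping inside the middle block of repeated letters of an accepted word. -/
theorem DFA.exists_replicate_lt_card {α σ : Type*} [Fintype σ] (M : DFA α σ) (u w : List α)
    (a : α) (h : ∃ l, u ++ (List.replicate l a ++ w) ∈ M.accepts) :
    ∃ l < Fintype.card σ, u ++ (List.replicate l a ++ w) ∈ M.accepts := by
  classical
  let q : ℕ → σ := fun j => M.eval (u ++ List.replicate j a)
  have key : ∀ j d, u ++ (List.replicate (j + d) a ++ w) ∈ M.accepts ↔
      M.evalFrom (q j) (List.replicate d a ++ w) ∈ M.accept := fun j d => by
    simp only [q, DFA.mem_accepts, DFA.eval, DFA.evalFrom_of_append, List.replicate_add]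
  refine ⟨Nat.find h, ?_, Nat.find_spec h⟩
  by_contra! hle
  obtain ⟨i, j, hne, hij⟩ := Fintype.exists_ne_map_eq_of_card_lt
    (fun i : Fin (Fintype.card σ + 1) => q i) (by simp)
  wlog hlt : i < j generalizing i j
  · exact this j i hne.symm hij.symm (lt_of_le_of_ne (not_lt.mp hlt) hne.symm)
  obtain ⟨d, hd⟩ := Nat.exists_eq_add_of_le (show (j : ℕ) ≤ Nat.find h by omega)
  have hacc := Nat.find_spec h
  rw [hd, key, ← hij, ← key] at hacc
  exact Nat.find_min h (by have : (i : ℕ) < j := hlt; omega) hacc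

/-- If `U` is a numeration system satisfying (H2) and the language of all
greedy `U`-representations is accepted by a DFA with `C` states, then for every greedy
`U`-representation `w` there is `ℓ < C` such that `1 0^ℓ w` is also a greedy
`U`-representation. -/
theorem stmt1 (U : ℕ → ℕ) (hU : IsNumSys U) (h2 : GapsUnbounded U)
    (σ : Type) [Fintype σ] (M : DFA ℕ σ)
    (hM : M.accepts = {w : List ℕ | IsGreedyRep U w})
    (C : ℕ) (hC : Fintype.card σ = C)
    (w : List ℕ) (hw : IsGreedyRep U w) :
    ∃ ℓ < C, IsGreedyRep U (1 :: (List.replicate ℓ 0 ++ w)) := by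
  have hacc (v : List ℕ) : v ∈ M.accepts ↔ IsGreedyRep U v := by rw [hM]; rfl
  obtain ⟨l, hl⟩ := hw.exists_one_zeros hU h2
  obtain ⟨l, hlC, hl⟩ := M.exists_replicate_lt_card [1] w 0 ⟨l, (hacc _).mpr hl⟩
  exact ⟨l, hC ▸ hlC, (hacc _).mp hl⟩
end

section
/- Let U be a numeration system satisfying (H1), (H2) and (H3). Then there exists an integer Z ≥ 0 such that for every greedy U-representation w and every z ≥ Z, the word 10^z w is also a greedy U-representation. -/
/-- A language is regular if it is accepted by a DFA with finitely many states. -/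
def IsRegularLang {α : Type} (L : Language α) : Prop :=
  ∃ (σ : Type) (_ : Fintype σ) (M : DFA α σ), M.accepts = L

/-- (H3): the gap sequence is ultimately non-decreasing. -/
def GapsUltNondecreasing (U : ℕ → ℕ) : Prop :=
  ∃ G : ℕ, ∀ i ≥ G, U (i + 1) - U i ≤ U (i + 2) - U (i + 1)

/-- In a greedy representation, padded with leading zeros, every suffix satisfies the greedy
bound. -/
theorem IsGreedyRep.sum_range_lt {U : ℕ → ℕ} (hU : StrictMono U) {w : List ℕ}
    (hw : IsGreedyRep U w) (t : ℕ) :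
    ∑ i ∈ Finset.range (t + 1), w.reverse.getD i 0 * U i < U (t + 1) := by
  induction t with
  | zero =>
    by_cases h : 0 < w.length
    · exact hw.2 0 h
    · have : w = [] := List.length_eq_zero_iff.mp (by omega)
      subst this
      simpa using (Nat.zero_le _).trans_lt (hU Nat.zero_lt_one)
  | succ t ih =>
    by_cases h : t + 1 < w.length
    · exact hw.2 _ h
    · rw [Finset.sum_range_succ, List.getD_eq_default _ _ (by simp; omega), zero_mul, add_zero]
      exact ih.trans (hU (Nat.lt_succ_self _))

/-- Prefixing a greedy representation with `1 0^N` is greedy as soon as the relevant gap of `U`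
exceeds the value of the representation. -/
theorem IsGreedyRep.one_zeros_append {U : ℕ → ℕ} (hU : StrictMono U) {w : List ℕ}
    (hw : IsGreedyRep U w) {N : ℕ}
    (hN : ∑ i ∈ Finset.range w.length, w.reverse.getD i 0 * U i <
      U (N + w.length + 1) - U (N + w.length)) :
    IsGreedyRep U (1 :: (List.replicate N 0 ++ w)) := by
  have hlow : ∀ t ≤ N + w.length,
      ∑ i ∈ Finset.range t, (1 :: (List.replicate N 0 ++ w)).reverse.getD i 0 * U i =
        ∑ i ∈ Finset.range t, w.reverse.getD i 0 * U i := by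
    intro t ht
    refine Finset.sum_congr rfl fun i hi => ?_
    have hi := Finset.mem_range.mp hi
    congr 1
    simp only [List.reverse_cons, List.reverse_append, List.reverse_replicate]
    rw [List.getD_append _ _ _ _ (by simp; omega)]
    by_cases h : i < w.length
    · rw [List.getD_append _ _ _ _ (by simpa using h)]
    · rw [List.getD_append_right _ _ _ _ (by simpa using h),
        List.getD_eq_default w.reverse _ (by simpa using h), List.getD_replicate]
      simp; omega
  have htop : (1 :: (List.replicate N 0 ++ w)).reverse.getD (N + w.length) 0 = 1 := by
    rw [List.reverse_cons, List.getD_append_right _ _ _ _ (by simp [add_comm])]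
    simp [add_comm]
  have hval : ∑ i ∈ Finset.range (N + w.length), w.reverse.getD i 0 * U i =
      ∑ i ∈ Finset.range w.length, w.reverse.getD i 0 * U i := by
    refine (Finset.sum_subset (Finset.range_mono (by omega)) fun i _ hi => ?_).symm
    rw [List.getD_eq_default _ _ (by simpa using hi), zero_mul]
  refine ⟨by simp, fun t ht => ?_⟩
  simp only [List.length_cons, List.length_append, List.length_replicate] at ht
  rcases Nat.lt_or_ge t (N + w.length) with h | h
  · rw [hlow _ h]
    exact hw.sum_range_lt hU t
  · obtain rfl : t = N + w.length := by omega
    rw [Finset.sum_range_succ, hlow _ le_rfl, htop, hval]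
    omega

/-- Unbounded, ultimately non-decreasing gaps tend to infinity. -/
theorem GapsUnbounded.tendsto_atTop {U : ℕ → ℕ} (h2 : GapsUnbounded U)
    (h3 : GapsUltNondecreasing U) :
    Filter.Tendsto (fun i => U (i + 1) - U i) Filter.atTop Filter.atTop := by
  obtain ⟨G, hG⟩ := h3
  refine Filter.tendsto_atTop.mpr fun B => ?_
  obtain ⟨m, hm, hB⟩ := Filter.frequently_atTop.mp (h2 B) G
  filter_upwards [Filter.eventually_ge_atTop m] with i hi
  induction i, hi using Nat.le_induction with
  | base => exact hB
  | succ i hi ih => exact ih.trans (hG i (hm.trans hi))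

/-- For a DFA, membership of `u a^z v` is ultimately periodic in `z`, with a preperiod and a
period that do not depend on `v`. -/
theorem DFA.exists_preperiod_append_replicate {α σ : Type*} [Finite σ] (M : DFA α σ)
    (u : List α) (a : α) :
    ∃ p q : ℕ, 0 < q ∧ ∀ (v : List α), ∀ z ≥ p, ∀ m : ℕ,
      u ++ (List.replicate (z + m * q) a ++ v) ∈ M.accepts ↔
        u ++ (List.replicate z a ++ v) ∈ M.accepts := by
  let s : ℕ → σ := fun z => M.eval (u ++ List.replicate z a)
  have hs : ∀ x y, s (x + y) = M.evalFrom (s x) (List.replicate y a) := fun x y => by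
    simp only [s, DFA.eval, List.replicate_add, DFA.evalFrom_of_append]
  obtain ⟨i, j, hij, he⟩ : ∃ i j, i < j ∧ s i = s j := by
    obtain ⟨i, j, hne, he⟩ := Finite.exists_ne_map_eq_of_infinite s
    rcases hne.lt_or_gt with h | h
    · exact ⟨i, j, h, he⟩
    · exact ⟨j, i, h, he.symm⟩
  have hstep : ∀ z ≥ i, s (z + (j - i)) = s z := fun z hz => by
    rw [show z + (j - i) = j + (z - i) by omega, hs, ← he, ← hs, Nat.add_sub_cancel' hz]
  have hper : ∀ z ≥ i, ∀ m, s (z + m * (j - i)) = s z := fun z hz m => by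
    induction m with
    | zero => simp
    | succ m ih => rw [Nat.succ_mul, ← add_assoc, hstep _ (hz.trans (Nat.le_add_right _ _)), ih]
  refine ⟨i, j - i, by omega, fun v z hz m => ?_⟩
  have hmem : ∀ y, u ++ (List.replicate y a ++ v) ∈ M.accepts ↔
      M.evalFrom (s y) v ∈ M.accept := fun y => by
    rw [DFA.mem_accepts, ← List.append_assoc, DFA.eval, DFA.evalFrom_of_append]
    rfl
  rw [hmem, hmem, hper z hz]

/-- If `U` is a numeration system satisfying (H1), (H2) and (H3), then
there is `Z ≥ 0` such that for every greedy `U`-representation `w` and every `z ≥ Z`,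
the word `1 0^z w` is again a greedy `U`-representation. -/
theorem stmt2 (U : ℕ → ℕ) (hU : IsNumSys U)
    (h1 : IsRegularLang {w : List ℕ | IsGreedyRep U w})
    (h2 : GapsUnbounded U) (h3 : GapsUltNondecreasing U) :
    ∃ Z : ℕ, ∀ w : List ℕ, IsGreedyRep U w →
      ∀ z ≥ Z, IsGreedyRep U (1 :: (List.replicate z 0 ++ w)) := by
  obtain ⟨σ, _, M, hM⟩ := h1
  have hmem : ∀ w, w ∈ M.accepts ↔ IsGreedyRep U w := fun w => by rw [hM]; rfl
  obtain ⟨p, q, hq, hpq⟩ := M.exists_preperiod_append_replicate [1] 0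
  refine ⟨p, fun w hw z hz => ?_⟩
  obtain ⟨m, hm⟩ := Filter.eventually_atTop.mp
    ((h2.tendsto_atTop h3).eventually_gt_atTop
      (∑ i ∈ Finset.range w.length, w.reverse.getD i 0 * U i))
  have hle : m ≤ z + m * q + w.length := by
    have := Nat.le_mul_of_pos_right m hq
    omega
  have hgreedy := hw.one_zeros_append hU.mono (hm _ hle)
  exact (hmem _).mp ((hpq w z hz m).mp ((hmem _).mpr hgreedy))
end

section
/- Let U = (U_i)_{i≥0} be an increasing sequence of positive integers with U_0 = 1 that ultimately satisfies a homogeneous linear recurrence with integer coefficients. Then for every integer Q ≥ 1, every r ≥ 0, and every finite alphabet A ⊆ ℕ, the language {w ∈ A* : val_U(w) ≡ r (mod Q)} is regular. -/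
/-- The `U`-numerical value of a word over `ℕ`, most significant digit first:
`valU U (xₗ ⋯ x₀) = ∑ xᵢ Uᵢ`. -/
def valU (U : ℕ → ℕ) (w : List ℕ) : ℕ :=
  ∑ i ∈ Finset.range w.length, w.reverse.getD i 0 * U i

/-- The value of a word extended by a least significant digit. -/
theorem valU_append_singleton (U : ℕ → ℕ) (w : List ℕ) (d : ℕ) :
    valU U (w ++ [d]) = valU (fun i => U (i + 1)) w + d * U 0 := by
  simp [valU, Finset.sum_range_succ']

/-- The sequences which satisfy the linear recurrence with coefficients `b` from index `M` on. -/
def ultimatelyRecurrent {R : Type} [CommRing R] {k : ℕ} (M : ℕ) (b : Fin k → R) :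
    Submodule R (ℕ → R) where
  carrier := {f | ∀ i ≥ M, f (i + k) = ∑ j : Fin k, b j * f (i + (j : ℕ))}
  zero_mem' := by simp
  add_mem' {f g} hf hg i hi := by
    simp [hf i hi, hg i hi, mul_add, Finset.sum_add_distrib]
  smul_mem' c f hf i hi := by
    simp only [Pi.smul_apply, smul_eq_mul, hf i hi, Finset.mul_sum]
    exact Finset.sum_congr rfl fun j _ => mul_left_comm _ _ _

namespace ultimatelyRecurrent

variable {R : Type} [CommRing R] {k M : ℕ} {b : Fin k → R}

/-- An ultimately recurrent sequence is determined by its first `M + k` terms. -/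
theorem ext_initial {f g : ultimatelyRecurrent M b} (h : ∀ i < M + k, f.1 i = g.1 i) :
    f = g := by
  refine Subtype.ext (funext fun n => ?_)
  induction n using Nat.strong_induction_on with
  | _ n ih =>
    by_cases hn : n < M + k
    · exact h n hn
    · obtain ⟨i, rfl⟩ : ∃ i, n = i + k := ⟨n - k, by omega⟩
      rw [f.2 i (by omega), g.2 i (by omega)]
      exact Finset.sum_congr rfl fun j _ => by rw [ih (i + j) (by omega)]

instance [Finite R] : Finite (ultimatelyRecurrent M b) :=
  Finite.of_injective (fun f (i : Fin (M + k)) => f.1 i) fun _ _ h =>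
    ext_initial fun i hi => congrFun h ⟨i, hi⟩

/-- Dropping the first term of an ultimately recurrent sequence. -/
def shift (f : ultimatelyRecurrent M b) : ultimatelyRecurrent M b :=
  ⟨fun i => f.1 (i + 1), fun i hi => by
    simpa only [add_right_comm] using f.2 (i + 1) (by omega)⟩

end ultimatelyRecurrent

section ShiftDFA

variable {R : Type} [CommRing R] {k M : ℕ} {b : Fin k → R}

/-- The automaton whose state after reading `w` is the sequence of the values of `w` in the shifts
of `u`, together with the truth value of `w` being a word over `A`. -/
def shiftDFA (A : Finset ℕ) (u : ultimatelyRecurrent M b) (r : R) :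
    DFA ℕ (ultimatelyRecurrent M b × Prop) where
  step s d := (ultimatelyRecurrent.shift s.1 + (d : R) • u, s.2 ∧ d ∈ A)
  start := (0, True)
  accept := {s | s.2 ∧ s.1.1 0 = r}

theorem shiftDFA_eval_fst (A : Finset ℕ) (u : ultimatelyRecurrent M b) (r : R) (U : ℕ → ℕ)
    (hu : ∀ i, u.1 i = U i) (w : List ℕ) (j : ℕ) :
    ((shiftDFA A u r).eval w).1.1 j = (valU (fun i => U (i + j)) w : R) := by
  induction w using List.reverseRecOn generalizing j with
  | nil => simp [shiftDFA, valU]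
  | append_singleton w d ih =>
    rw [DFA.eval_append_singleton, valU_append_singleton]
    change ((shiftDFA A u r).eval w).1.1 (j + 1) + (d : R) * u.1 j = _
    rw [ih, hu]
    simp only [Nat.cast_add, Nat.cast_mul, zero_add, add_assoc, add_comm 1 j]

theorem shiftDFA_eval_snd (A : Finset ℕ) (u : ultimatelyRecurrent M b) (r : R) (w : List ℕ) :
    ((shiftDFA A u r).eval w).2 ↔ ∀ d ∈ w, d ∈ A := by
  induction w using List.reverseRecOn with
  | nil => simp [shiftDFA]
  | append_singleton w d ih =>
    rw [DFA.eval_append_singleton]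
    change ((shiftDFA A u r).eval w).2 ∧ d ∈ A ↔ _
    rw [ih]
    simp [or_imp, forall_and]

end ShiftDFA

/-- Let `U` be an increasing sequence of positive integers with `U 0 = 1`
ultimately satisfying a homogeneous linear recurrence with integer coefficients. Then for
every `Q ≥ 1`, every `r`, and every finite alphabet `A ⊆ ℕ`, the language
`{w ∈ A* : val_U(w) ≡ r (mod Q)}` is regular. -/
theorem stmt3 (U : ℕ → ℕ) (hmono : StrictMono U) (hpos : ∀ i, 0 < U i) (h0 : U 0 = 1)
    (k : ℕ) (hk : 1 ≤ k) (b : Fin k → ℤ) (M : ℕ)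
    (hrec : ∀ i ≥ M, (U (i + k) : ℤ) = ∑ j : Fin k, b j * U (i + (j : ℕ)))
    (Q : ℕ) (hQ : 1 ≤ Q) (r : ℕ) (A : Finset ℕ) :
    IsRegularLang {w : List ℕ | (∀ d ∈ w, d ∈ A) ∧ valU U w ≡ r [MOD Q]} := by
  have : NeZero Q := ⟨by omega⟩
  let u : ultimatelyRecurrent (R := ZMod Q) M (fun j => (b j : ZMod Q)) :=
    ⟨fun i => U i, fun i hi => by simpa using congrArg (Int.cast : ℤ → ZMod Q) (hrec i hi)⟩
  refine ⟨_ × Prop, Fintype.ofFinite _, shiftDFA A u r, ?_⟩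
  ext w
  have hval : ((shiftDFA A u r).eval w).1.1 0 = (valU U w : ZMod Q) :=
    shiftDFA_eval_fst A u r U (fun _ => rfl) w 0
  have hmem := shiftDFA_eval_snd A u r w
  rw [DFA.mem_accepts]
  change ((shiftDFA A u r).eval w).2 ∧ ((shiftDFA A u r).eval w).1.1 0 = (r : ZMod Q) ↔
    (∀ d ∈ w, d ∈ A) ∧ valU U w ≡ r [MOD Q]
  rw [hval, hmem, ZMod.natCast_eq_natCast_iff]
end

section
/- Let U be a numeration system. Suppose there exist an integer u ≥ 1, a real number β > 1, an index I, real polynomials P_0,…,P_{u−1} all of the same degree and with positive leading coefficients, and functions Q_0,…,Q_{u−1} : ℕ → ℝ with Q_r(i)/β^i → 0 as i → ∞, such that U_{ui+r} = P_r(i)·β^i + Q_r(i) for all i ≥ I and all 0 ≤ r < u. Let T < u be an index such that the leading coefficient of P_T is maximal among those of P_0,…,P_{u−1}. Then there exist constants K, L ≥ 0 such that for all sufficiently large n: |rep_U(n)| < u·log_β(n) + K and |rep_U(n)| > u·log_β(n) − u·log_β(P_T(log_β(n) + K/u)) − L. -/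
/-- The length of the greedy `U`-representation of `n`: for `n ≥ 1` it is the least `ℓ`
with `n < U ℓ` (and it is `0` for `n = 0`, since `U 0 = 1`). -/
noncomputable def repLen (U : ℕ → ℕ) (n : ℕ) : ℕ := sInf {ℓ : ℕ | n < U ℓ}

open Filter Topology

theorem Polynomial.eventually_bounds_of_leadingCoeff_pos (p : Polynomial ℝ)
    (hp : 0 < p.leadingCoeff) :
    ∀ᶠ x : ℝ in atTop, p.leadingCoeff / 2 * x ^ p.natDegree ≤ p.eval x ∧
      p.eval x ≤ 2 * p.leadingCoeff * x ^ p.natDegree := by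
  have h := p.isEquivalent_atTop_lead.isLittleO.def (c := 1 / 2) (by norm_num)
  filter_upwards [h, eventually_ge_atTop 0] with x hx hx0
  have h0 : 0 ≤ p.leadingCoeff * x ^ p.natDegree := by positivity
  simp only [Pi.sub_apply, Real.norm_eq_abs, abs_of_nonneg h0] at hx
  obtain ⟨h1, h2⟩ := abs_le.mp hx
  constructor <;> linarith

theorem eventually_exp_poly_bounds (p : Polynomial ℝ) (hp : 0 < p.leadingCoeff) {β : ℝ}
    (hβ : 1 < β) (q : ℕ → ℝ) (hq : Tendsto (fun i : ℕ => q i / β ^ i) atTop (𝓝 0)) :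
    ∀ᶠ i : ℕ in atTop, p.leadingCoeff / 4 * β ^ i ≤ p.eval (i : ℝ) * β ^ i + q i ∧
      p.eval (i : ℝ) * β ^ i + q i ≤
        (2 * p.leadingCoeff + 1) * (i : ℝ) ^ p.natDegree * β ^ i := by
  filter_upwards [tendsto_natCast_atTop_atTop.eventually
      (p.eventually_bounds_of_leadingCoeff_pos hp), eventually_ge_atTop 1,
    hq.eventually_lt_const one_pos,
    hq.eventually_const_lt (show -(p.leadingCoeff / 4) < 0 by linarith)] with i h hi h1 h2
  have hb : 0 < β ^ i := by positivity
  have hpow : (1 : ℝ) ≤ (i : ℝ) ^ p.natDegree := one_le_pow₀ (by exact_mod_cast hi)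
  have hsplit : p.eval (i : ℝ) * β ^ i + q i = (p.eval (i : ℝ) + q i / β ^ i) * β ^ i := by
    field_simp
  rw [hsplit]
  constructor
  · refine mul_le_mul_of_nonneg_right ?_ hb.le
    nlinarith [h.1]
  · refine mul_le_mul_of_nonneg_right ?_ hb.le
    nlinarith [h.2]

theorem IsNumSys.lt_repLen {U : ℕ → ℕ} (hU : IsNumSys U) (n : ℕ) : n < U (repLen U n) :=
  Nat.sInf_mem (s := {ℓ : ℕ | n < U ℓ}) ⟨n + 1, hU.mono.id_le (n + 1)⟩

theorem le_of_lt_repLen {U : ℕ → ℕ} {m n : ℕ} (h : m < repLen U n) : U m ≤ n :=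
  not_lt.mp (Nat.notMem_of_lt_sInf (s := {ℓ : ℕ | n < U ℓ}) h)

/-- Suppose `U (u*i + r) = P r (i) * β^i + Q r (i)` for `i ≥ I`, where
`β > 1`, the `P r` are real polynomials of a common degree with positive leading
coefficients, `Q r i / β^i → 0`, and `T` has maximal leading coefficient. Then there are
constants `K, L ≥ 0` with, for all large `n`,
`|rep_U(n)| < u logᵦ n + K` and `|rep_U(n)| > u logᵦ n − u logᵦ (P T (logᵦ n + K/u)) − L`. -/
theorem stmt4 (U : ℕ → ℕ) (hU : IsNumSys U)
    (u : ℕ) (hu : 1 ≤ u) (β : ℝ) (hβ : 1 < β) (I : ℕ)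
    (P : Fin u → Polynomial ℝ) (Q : Fin u → ℕ → ℝ)
    (hdeg : ∀ r s : Fin u, (P r).natDegree = (P s).natDegree)
    (hlead : ∀ r : Fin u, 0 < (P r).leadingCoeff)
    (hQ : ∀ r : Fin u, Filter.Tendsto (fun i : ℕ => Q r i / β ^ i) Filter.atTop (nhds 0))
    (heq : ∀ i ≥ I, ∀ r : Fin u,
      (U (u * i + (r : ℕ)) : ℝ) = (P r).eval (i : ℝ) * β ^ i + Q r i)
    (T : Fin u) (hT : ∀ r : Fin u, (P r).leadingCoeff ≤ (P T).leadingCoeff) :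
    ∃ K L : ℝ, 0 ≤ K ∧ 0 ≤ L ∧ ∃ N : ℕ, ∀ n ≥ N,
      (repLen U n : ℝ) < u * Real.logb β n + K ∧
      (repLen U n : ℝ) >
        u * Real.logb β n - u * Real.logb β ((P T).eval (Real.logb β n + K / u)) - L := by
  have : Nonempty (Fin u) := ⟨T⟩
  obtain ⟨R, hR⟩ := Finite.exists_min fun r => (P r).leadingCoeff
  set c := (P R).leadingCoeff / 4
  set A := 2 * (P T).leadingCoeff + 1
  set d := (P T).natDegree
  set B := (P T).leadingCoeff / 2
  have hc : 0 < c := div_pos (hlead R) (by norm_num)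
  have hA : 0 < A := by have := hlead T; positivity
  have hB : 0 < B := div_pos (hlead T) (by norm_num)
  have hbounds : ∀ᶠ i : ℕ in atTop, ∀ r : Fin u, c * β ^ i ≤ (U (u * i + (r : ℕ)) : ℝ) ∧
      (U (u * i + (r : ℕ)) : ℝ) ≤ A * (i : ℝ) ^ d * β ^ i := by
    refine eventually_all.mpr fun r => ?_
    filter_upwards [eventually_exp_poly_bounds (P r) (hlead r) hβ (Q r) (hQ r),
      eventually_ge_atTop I] with i h hi
    rw [heq i hi r]
    refine ⟨le_trans ?_ h.1, h.2.trans ?_⟩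
    · gcongr
      have := hR r
      simp only [c]
      linarith
    · rw [hdeg r T]
      gcongr
      have := hT r
      simp only [A]
      linarith
  obtain ⟨M₁, hM₁⟩ := eventually_atTop.mp hbounds
  obtain ⟨Y, hY⟩ := eventually_atTop.mp
    ((P T).eventually_bounds_of_leadingCoeff_pos (hlead T))
  set M := max (max M₁ ⌈Y⌉₊) 1
  have hu0 : (0 : ℝ) < u := by exact_mod_cast hu
  have hβ0 : 0 < β := by linarith
  set K := max 0 (u - u * Real.logb β c + 1)
  set L := max 0 (u * Real.logb β (A / B))
  refine ⟨K, L, le_max_left _ _, le_max_left _ _, U (u * M), fun n hn => ?_⟩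
  set ℓ := repLen U n
  have hℓ : u * M < ℓ := hU.mono.lt_iff_lt.mp (hn.trans_lt (hU.lt_repLen n))
  have hn0 : (0 : ℝ) < n := by
    have h1 := hU.mono.monotone (Nat.zero_le (u * M))
    rw [hU.base] at h1
    exact_mod_cast (Nat.lt_of_lt_of_le Nat.one_pos (h1.trans hn))
  have hupper : (ℓ : ℝ) < u * Real.logb β n + K := by
    set i := (ℓ - 1) / u
    have hi : M ≤ i := (Nat.le_div_iff_mul_le hu).mpr (by rw [mul_comm]; omega)
    have hmod : (ℓ - 1) % u < u := Nat.mod_lt _ hu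
    have hdm : u * i + (ℓ - 1) % u = ℓ - 1 := Nat.div_add_mod _ _
    have hb := (hM₁ i (by omega) ⟨_, hmod⟩).1
    simp only [hdm] at hb
    have hUn : (U (ℓ - 1) : ℝ) ≤ n := by
      exact_mod_cast le_of_lt_repLen (show ℓ - 1 < repLen U n by omega)
    have hlog := Real.logb_le_logb_of_le hβ (by positivity) (hb.trans hUn)
    rw [Real.logb_mul hc.ne' (by positivity), Real.logb_pow, Real.logb_self_eq_one hβ,
      mul_one] at hlog
    have hle : (ℓ : ℝ) ≤ u * i + u := by
      exact_mod_cast (show ℓ ≤ u * i + u by omega)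
    have hK : u - u * Real.logb β c + 1 ≤ K := le_max_right _ _
    nlinarith [mul_le_mul_of_nonneg_left hlog hu0.le]
  refine ⟨hupper, ?_⟩
  set y := Real.logb β n + K / u
  set i := ℓ / u
  have hi : M ≤ i := (Nat.le_div_iff_mul_le hu).mpr (by rw [mul_comm]; omega)
  have hmod : ℓ % u < u := Nat.mod_lt _ hu
  have hdm : u * i + ℓ % u = ℓ := Nat.div_add_mod _ _
  have hb := (hM₁ i (by omega) ⟨_, hmod⟩).2
  simp only [hdm] at hb
  have hil : (u : ℝ) * i ≤ ℓ := by
    exact_mod_cast (show u * i ≤ ℓ by omega)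
  have hiy : (i : ℝ) ≤ y := by
    refine le_of_mul_le_mul_left ?_ hu0
    have hy : u * y = u * Real.logb β n + K := by
      simp only [y]
      field_simp
    linarith
  have hi1 : (1 : ℝ) ≤ i := by exact_mod_cast (show 1 ≤ i by omega)
  have hYi : Y ≤ i := (Nat.le_ceil Y).trans (by exact_mod_cast (show ⌈Y⌉₊ ≤ i by omega))
  have hPy : B * y ^ d ≤ (P T).eval y := (hY y (hYi.trans hiy)).1
  have hy0 : 0 < y := by linarith
  have hP0 : 0 < (P T).eval y := lt_of_lt_of_le (by positivity) hPy
  have hnU : (n : ℝ) < U ℓ := by exact_mod_cast hU.lt_repLen n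
  have hnP : (n : ℝ) < A / B * (P T).eval y * β ^ i := by
    calc (n : ℝ) < A * (i : ℝ) ^ d * β ^ i := hnU.trans_le hb
      _ ≤ A * y ^ d * β ^ i := by gcongr
      _ = A / B * (B * y ^ d) * β ^ i := by field_simp
      _ ≤ A / B * (P T).eval y * β ^ i := by gcongr
  have hlog := Real.logb_lt_logb hβ hn0 hnP
  rw [Real.logb_mul (by positivity) (by positivity), Real.logb_mul (by positivity) hP0.ne',
    Real.logb_pow, Real.logb_self_eq_one hβ, mul_one] at hlog
  have hL : u * Real.logb β (A / B) ≤ L := le_max_right _ _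
  nlinarith [mul_lt_mul_of_pos_left hlog hu0]
end

section
/- Let U = (U_i)_{i≥0} be an increasing sequence of positive integers, let k ≥ 1 be minimal such that U ultimately satisfies a homogeneous linear recurrence of order k with integer coefficients, and let a_0,…,a_{k−1} ∈ ℤ with a_0 ≠ 0 and N ≥ 0 be such that U_{i+k} = a_{k−1}U_{i+k−1} + ⋯ + a_0 U_i for all i ≥ N. Let p be a prime. Then the following are equivalent: (i) for every μ ≥ 1 there exists an index F such that p^μ divides U_i for all i ≥ F; (ii) p divides each of a_0, …, a_{k−1}. -/
/-- `U` ultimately satisfies a homogeneous linear recurrence of order `k` with integer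
coefficients. -/
def UltLinRec (U : ℕ → ℕ) (k : ℕ) : Prop :=
  ∃ (b : Fin k → ℤ) (M : ℕ), ∀ i ≥ M, (U (i + k) : ℤ) = ∑ j : Fin k, b j * U (i + (j : ℕ))

open Polynomial in
/-- Coefficients of a polynomial times a power series, beyond a degree bound of the polynomial. -/
lemma PowerSeries.coeff_add_coe_mul {R : Type*} [CommRing R] (Q : R[X]) (S : PowerSeries R) {k : ℕ}
    (hQ : Q.natDegree ≤ k) (i : ℕ) :
    PowerSeries.coeff (i + k) ((Q : PowerSeries R) * S) =
      ∑ j ∈ Finset.range (k + 1), Q.coeff (k - j) * PowerSeries.coeff (i + j) S := by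
  rw [PowerSeries.coeff_mul, Finset.Nat.sum_antidiagonal_eq_sum_range_succ_mk,
    ← Finset.sum_range_reflect (fun j => Q.coeff (k - j) * PowerSeries.coeff (i + j) S)]
  simp only [Polynomial.coeff_coe]
  symm
  apply Finset.sum_subset_zero_on_sdiff
  · intro x hx
    simp only [Finset.mem_range] at *
    omega
  · intro x hx
    simp only [Finset.mem_sdiff, Finset.mem_range] at hx
    rw [Polynomial.coeff_eq_zero_of_natDegree_lt (by omega), zero_mul]
  · intro x hx
    simp only [Finset.mem_range] at hx
    rw [show k - (k + 1 - 1 - x) = x by omega, show i + (k + 1 - 1 - x) = i + k - x by omega]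

open Polynomial in
lemma PowerSeries.exists_polynomial_of_coeff_eq_zero {R : Type*} [CommRing R] (f : PowerSeries R)
    (n : ℕ) (h : ∀ m ≥ n, PowerSeries.coeff m f = 0) : ∃ P : R[X], (P : PowerSeries R) = f := by
  refine ⟨PowerSeries.trunc n f, ?_⟩
  ext m
  rw [Polynomial.coeff_coe, PowerSeries.coeff_trunc]
  split_ifs with hm
  · rfl
  · exact (h m (not_lt.mp hm)).symm

open Polynomial in
/-- Relatively prime integer polynomials have a Bezout identity with a nonzero constant
right-hand side. -/
lemma Polynomial.exists_bezout_of_isRelPrime_int {A Q : ℤ[X]} (hQ : Q ≠ 0) (h : IsRelPrime A Q) :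
    ∃ (B D : ℤ[X]) (d : ℤ), d ≠ 0 ∧ B * A + D * Q = C d := by
  let φ := algebraMap ℤ ℚ
  have hinj : Function.Injective φ := IsFractionRing.injective ℤ ℚ
  have hcop : IsCoprime (A.map φ) (Q.map φ) := by
    rw [← isRelPrime_iff_isCoprime]
    intro g hgA hgQ
    have hg0 : g ≠ 0 := by
      rintro rfl
      exact hQ ((Polynomial.map_eq_zero_iff hinj).mp (zero_dvd_iff.mp hgQ))
    set g' := (IsLocalization.integerNormalization (nonZeroDivisors ℤ) g).primPart with hg'
    have hprim : g'.IsPrimitive := isPrimitive_primPart _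
    have hdvd : g'.map φ ∣ g := by
      obtain ⟨b, hb, hbg⟩ := IsLocalization.integerNormalization_spec (nonZeroDivisors ℤ) g
      have hb0 : (b : ℚ) ≠ 0 := by exact_mod_cast nonZeroDivisors.ne_zero hb
      have h1 : g'.map φ ∣ b • g := by
        rw [← hbg]
        exact Polynomial.map_dvd φ (primPart_dvd _)
      have h2 : b • g = C (b : ℚ) * g := by
        rw [zsmul_eq_mul]; simp
      rw [h2] at h1
      exact (IsUnit.dvd_mul_left (isUnit_C.mpr (isUnit_iff_ne_zero.mpr hb0))).mp h1
    exact (isUnit_or_eq_zero_of_isUnit_integerNormalization_primPart hg0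
      (h (hprim.dvd_of_fraction_map_dvd_fraction_map (K := ℚ) (hdvd.trans hgA))
        (hprim.dvd_of_fraction_map_dvd_fraction_map (K := ℚ) (hdvd.trans hgQ))))
  obtain ⟨u, v, huv⟩ := hcop
  obtain ⟨b, hb, hbu⟩ := IsLocalization.integerNormalization_spec (nonZeroDivisors ℤ) u
  obtain ⟨c, hc, hcv⟩ := IsLocalization.integerNormalization_spec (nonZeroDivisors ℤ) v
  refine ⟨C c * IsLocalization.integerNormalization (nonZeroDivisors ℤ) u,
    C b * IsLocalization.integerNormalization (nonZeroDivisors ℤ) v, b * c,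
    mul_ne_zero (nonZeroDivisors.ne_zero hb) (nonZeroDivisors.ne_zero hc), ?_⟩
  apply Polynomial.map_injective φ hinj
  simp only [Polynomial.map_add, Polynomial.map_mul, Polynomial.map_C]
  rw [hbu, hcv, zsmul_eq_mul, zsmul_eq_mul]
  simp only [φ, algebraMap_int_eq, eq_intCast, map_mul, map_intCast] at huv ⊢
  linear_combination (b * c : ℚ[X]) * huv

open Polynomial in
/-- If a polynomial of degree at most `k` with unit constant coefficient multiplies the
generating function of `U` to a polynomial, then `U` ultimately satisfies a recurrence of
order `k`. -/
lemma UltLinRec.of_coe_mul_eq {U : ℕ → ℕ} {k : ℕ} {A Q : ℤ[X]} (hQ : Q.natDegree ≤ k)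
    (hQ0 : IsUnit (Q.coeff 0))
    (h : (Q : PowerSeries ℤ) * PowerSeries.mk (fun n => (U n : ℤ)) = A) : UltLinRec U k := by
  obtain ⟨e, he⟩ := hQ0.exists_left_inv
  refine ⟨fun j => -e * Q.coeff (k - j), A.natDegree + 1, fun i hi => ?_⟩
  have h1 := PowerSeries.coeff_add_coe_mul Q (PowerSeries.mk fun n => (U n : ℤ)) hQ i
  rw [h, Polynomial.coeff_coe, Polynomial.coeff_eq_zero_of_natDegree_lt (by omega),
    Finset.sum_range_succ] at h1
  simp only [PowerSeries.coeff_mk, Nat.sub_self] at h1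
  rw [Fin.sum_univ_eq_sum_range (fun j => -e * Q.coeff (k - j) * (U (i + j) : ℤ)) k]
  simp only [mul_assoc]
  rw [← Finset.mul_sum]
  linear_combination (-(U (i + k) : ℤ)) * he - e * h1

open Polynomial in
/-- The reciprocal of the characteristic polynomial `X ^ k - ∑ a j X ^ j`. -/
noncomputable def reciprocalCharpoly {k : ℕ} (a : Fin k → ℤ) : ℤ[X] :=
  1 - ∑ j : Fin k, C (a j) * X ^ (k - (j : ℕ))

lemma natDegree_reciprocalCharpoly_le {k : ℕ} (a : Fin k → ℤ) :
    (reciprocalCharpoly a).natDegree ≤ k := by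
  refine (Polynomial.natDegree_sub_le _ _).trans (max_le (by simp) ?_)
  refine Polynomial.natDegree_sum_le_of_forall_le _ _ fun j _ => ?_
  exact (Polynomial.natDegree_C_mul_X_pow_le _ _).trans (Nat.sub_le _ _)

lemma coeff_reciprocalCharpoly_zero {k : ℕ} (a : Fin k → ℤ) :
    (reciprocalCharpoly a).coeff 0 = 1 := by
  simp only [reciprocalCharpoly, Polynomial.coeff_sub, Polynomial.coeff_one_zero,
    Polynomial.finsetSum_coeff, Polynomial.coeff_C_mul_X_pow]
  rw [Finset.sum_eq_zero, sub_zero]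
  intro j _
  rw [if_neg (by omega)]

lemma coeff_reciprocalCharpoly_sub {k : ℕ} (a : Fin k → ℤ) (j : Fin k) :
    (reciprocalCharpoly a).coeff (k - j) = -a j := by
  simp only [reciprocalCharpoly, Polynomial.coeff_sub, Polynomial.coeff_one,
    Polynomial.finsetSum_coeff, Polynomial.coeff_C_mul_X_pow]
  rw [if_neg (by omega), Finset.sum_eq_single j, if_pos rfl, zero_sub]
  · intro i _ hij
    rw [if_neg]
    intro h
    exact hij (Fin.ext (by omega))
  · simp

open Polynomial in
lemma exists_reciprocalCharpoly_mul_eq {U : ℕ → ℕ} {k N : ℕ} {a : Fin k → ℤ}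
    (hrec : ∀ i ≥ N, (U (i + k) : ℤ) = ∑ j : Fin k, a j * U (i + (j : ℕ))) :
    ∃ A : ℤ[X], (A : PowerSeries ℤ) =
      (reciprocalCharpoly a : PowerSeries ℤ) * PowerSeries.mk (fun n => (U n : ℤ)) := by
  refine PowerSeries.exists_polynomial_of_coeff_eq_zero _ (N + k) fun m hm => ?_
  obtain ⟨i, rfl⟩ : ∃ i, m = i + k := ⟨m - k, by omega⟩
  rw [PowerSeries.coeff_add_coe_mul _ _ (natDegree_reciprocalCharpoly_le a),
    Finset.sum_range_succ, Nat.sub_self, coeff_reciprocalCharpoly_zero,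
    ← Fin.sum_univ_eq_sum_range
      (fun j => (reciprocalCharpoly a).coeff (k - j) * PowerSeries.coeff (i + j) _) k]
  simp only [coeff_reciprocalCharpoly_sub, PowerSeries.coeff_mk]
  rw [hrec i (by omega)]
  simp

open Polynomial in
/-- If the order `k` is minimal, numerator and denominator of the generating function are
relatively prime. -/
lemma isRelPrime_of_minimal {U : ℕ → ℕ} (hpos : ∀ i, 0 < U i) {k : ℕ} (hk : 1 ≤ k)
    (hkmin : ∀ k', 1 ≤ k' → UltLinRec U k' → k ≤ k') {A Q : ℤ[X]} (hQ : Q.natDegree ≤ k)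
    (hQ0 : Q.coeff 0 = 1)
    (h : (A : PowerSeries ℤ) = (Q : PowerSeries ℤ) * PowerSeries.mk (fun n => (U n : ℤ))) :
    IsRelPrime A Q := by
  rintro G ⟨A', rfl⟩ ⟨Q', rfl⟩
  rw [Polynomial.mul_coeff_zero] at hQ0
  have hG0 : G ≠ 0 := by rintro rfl; simp at hQ0
  have hQ'0 : Q' ≠ 0 := by rintro rfl; simp at hQ0
  rw [Polynomial.natDegree_mul hG0 hQ'0] at hQ
  rcases Nat.eq_zero_or_pos G.natDegree with hdeg | hdeg
  · rw [Polynomial.eq_C_of_natDegree_eq_zero hdeg]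
    exact Polynomial.isUnit_C.mpr (IsUnit.of_mul_eq_one _ hQ0)
  · exfalso
    have hcancel : (Q' : PowerSeries ℤ) * PowerSeries.mk (fun n => (U n : ℤ)) = A' := by
      rw [Polynomial.coe_mul, Polynomial.coe_mul, mul_assoc] at h
      exact (mul_left_cancel₀ (by rwa [Ne, Polynomial.coe_eq_zero_iff]) h).symm
    have hrec : UltLinRec U (k - 1) := UltLinRec.of_coe_mul_eq (by omega)
      (IsUnit.of_mul_eq_one (G.coeff 0) (by rw [mul_comm]; exact hQ0)) hcancel
    rcases Nat.eq_zero_or_pos (k - 1) with h0 | h0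
    · rw [h0] at hrec
      obtain ⟨b, M, hM⟩ := hrec
      have h1 := hM M le_rfl
      have h2 := hpos M
      simp at h1
      omega
    · have := hkmin _ h0 hrec
      omega

open Polynomial in
/-- If the inverse power series of `Q` has all but finitely many coefficients divisible by `p`,
then so are
all nonconstant coefficients of `Q`. -/
lemma Polynomial.dvd_coeff_of_mul_eq_one {p : ℕ} (hp : p.Prime) {Q : ℤ[X]} {T : PowerSeries ℤ}
    (hQT : (Q : PowerSeries ℤ) * T = 1) {F : ℕ}
    (hT : ∀ n ≥ F, (p : ℤ) ∣ PowerSeries.coeff n T) {j : ℕ} (hj : j ≠ 0) : (p : ℤ) ∣ Q.coeff j := by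
  have := Fact.mk hp
  let φ := Int.castRingHom (ZMod p)
  obtain ⟨P, hP⟩ := PowerSeries.exists_polynomial_of_coeff_eq_zero (PowerSeries.map φ T) F
    fun n hn => by
      rw [PowerSeries.coeff_map]
      exact (ZMod.intCast_zmod_eq_zero_iff_dvd _ _).mpr (hT n hn)
  have hmul : Q.map φ * P = 1 := by
    apply Polynomial.coe_injective
    rw [Polynomial.coe_mul, hP, Polynomial.coe_one, Polynomial.polynomial_map_coe, ← map_mul,
      hQT, map_one]
  obtain ⟨r, -, hr⟩ := Polynomial.isUnit_iff.mp (IsUnit.of_mul_eq_one _ hmul)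
  have hc : (Q.map φ).coeff j = 0 := by rw [← hr, Polynomial.coeff_C, if_neg hj]
  rw [Polynomial.coeff_map] at hc
  exact (ZMod.intCast_zmod_eq_zero_iff_dvd _ _).mp hc

lemma exists_pow_dvd_of_dvd_coeffs {U : ℕ → ℕ} {k N : ℕ} {a : Fin k → ℤ}
    (hrec : ∀ i ≥ N, (U (i + k) : ℤ) = ∑ j : Fin k, a j * U (i + (j : ℕ))) {p : ℕ}
    (h : ∀ j : Fin k, (p : ℤ) ∣ a j) (μ : ℕ) : ∃ F : ℕ, ∀ i ≥ F, p ^ μ ∣ U i := by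
  induction μ with
  | zero => exact ⟨0, by simp⟩
  | succ μ ih =>
    obtain ⟨F, hF⟩ := ih
    refine ⟨max N F + k, fun m hm => ?_⟩
    obtain ⟨i, rfl⟩ : ∃ i, m = i + k := ⟨m - k, by omega⟩
    have : ((p ^ (μ + 1) : ℕ) : ℤ) ∣ (U (i + k) : ℤ) := by
      rw [hrec i (by omega)]
      refine Finset.dvd_sum fun j _ => ?_
      rw [pow_succ', Nat.cast_mul]
      exact mul_dvd_mul (h j) (Int.natCast_dvd_natCast.mpr (hF _ (by omega)))
    exact_mod_cast this

open Polynomial in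
/-- Eventual divisibility by `m` of the coefficients of a power series is preserved by
multiplying by a polynomial and by adding a polynomial. -/
lemma PowerSeries.exists_dvd_coeff_coe_mul_add (B D : ℤ[X]) (S : PowerSeries ℤ) {m : ℤ} {F : ℕ}
    (hS : ∀ n ≥ F, m ∣ PowerSeries.coeff n S) :
    ∃ F', ∀ n ≥ F', m ∣ PowerSeries.coeff n ((B : PowerSeries ℤ) * S + D) := by
  refine ⟨F + B.natDegree + D.natDegree + 1, fun n hn => ?_⟩
  obtain ⟨i, rfl⟩ : ∃ i, n = i + B.natDegree := ⟨n - B.natDegree, by omega⟩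
  rw [map_add, Polynomial.coeff_coe, Polynomial.coeff_eq_zero_of_natDegree_lt (by omega), add_zero,
    PowerSeries.coeff_add_coe_mul B S le_rfl]
  exact Finset.dvd_sum fun j _ => (hS _ (by omega)).mul_left _

/-- Let `U` be an increasing sequence of positive integers, `k ≥ 1`
minimal such that `U` ultimately satisfies a linear recurrence of order `k`, with
coefficients `a 0, …, a (k-1)`, `a 0 ≠ 0`, valid from `N` on. Let `p` be a prime.
Then `p^μ` divides `U i` for all large `i` and every `μ ≥ 1` iff `p` divides every
coefficient. -/
theorem stmt5 (U : ℕ → ℕ) (hmono : StrictMono U) (hpos : ∀ i, 0 < U i)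
    (k : ℕ) (hk : 1 ≤ k)
    (hkmin : ∀ k', 1 ≤ k' → UltLinRec U k' → k ≤ k')
    (a : Fin k → ℤ) (ha0 : a ⟨0, hk⟩ ≠ 0) (N : ℕ)
    (hrec : ∀ i ≥ N, (U (i + k) : ℤ) = ∑ j : Fin k, a j * U (i + (j : ℕ)))
    (p : ℕ) (hp : p.Prime) :
    (∀ μ : ℕ, 1 ≤ μ → ∃ F : ℕ, ∀ i ≥ F, p ^ μ ∣ U i) ↔ (∀ j : Fin k, (p : ℤ) ∣ a j) := by
  refine ⟨fun h j => ?_, fun h μ _ => exists_pow_dvd_of_dvd_coeffs hrec h μ⟩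
  obtain ⟨A, hA⟩ := exists_reciprocalCharpoly_mul_eq hrec
  have hQ0 := coeff_reciprocalCharpoly_zero a
  have hQne : reciprocalCharpoly a ≠ 0 := fun h0 => by simp [h0] at hQ0
  obtain ⟨B, D, d, hd, hBD⟩ := Polynomial.exists_bezout_of_isRelPrime_int hQne
    (isRelPrime_of_minimal hpos hk hkmin (natDegree_reciprocalCharpoly_le a) hQ0 hA)
  obtain ⟨T, hT⟩ : ∃ T, (reciprocalCharpoly a : PowerSeries ℤ) * T = 1 := by
    refine IsUnit.exists_right_inv (PowerSeries.isUnit_iff_constantCoeff.mpr ?_)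
    rw [← PowerSeries.coeff_zero_eq_constantCoeff_apply, Polynomial.coeff_coe, hQ0]
    exact isUnit_one
  set S := PowerSeries.mk fun n => (U n : ℤ) with hS
  have hdT : PowerSeries.C d * T = (B : PowerSeries ℤ) * S + D := by
    have h1 := congrArg (fun P : Polynomial ℤ => (P : PowerSeries ℤ)) hBD
    simp only [Polynomial.coe_add, Polynomial.coe_mul, Polynomial.coe_C, hA] at h1
    linear_combination (-T) * h1 + ((B : PowerSeries ℤ) * S + D) * hT
  have hpZ : Prime (p : ℤ) := Nat.prime_iff_prime_int.mp hp
  obtain ⟨μ, hμ⟩ := FiniteMultiplicity.of_prime_left hpZ hd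
  obtain ⟨F, hF⟩ := h (μ + 1) (by omega)
  obtain ⟨F', hF'⟩ := PowerSeries.exists_dvd_coeff_coe_mul_add B D S (m := (p : ℤ) ^ (μ + 1))
    (F := F) fun n hn => by
      rw [hS, PowerSeries.coeff_mk]
      exact_mod_cast hF n hn
  have hTp : ∀ n ≥ F', (p : ℤ) ∣ PowerSeries.coeff n T := fun n hn => by
    by_contra hnd
    have h1 := hF' n hn
    rw [← hdT, PowerSeries.coeff_C_mul] at h1
    exact hμ (hpZ.pow_dvd_of_dvd_mul_right _ hnd h1)
  have h2 := Polynomial.dvd_coeff_of_mul_eq_one hp hT hTp (j := k - j) (by omega)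
  rwa [coeff_reciprocalCharpoly_sub, dvd_neg] at h2
end

section
/- Let U be a numeration system satisfying (H1), (H2) and (H3) that is linear with coefficients a_0,…,a_{k−1}. Let p be a prime that does not divide all of a_0,…,a_{k−1}, and let λ ≥ 1 be an integer such that U_i ≢ 0 (mod p^λ) for infinitely many i. Let X ⊆ ℕ be an ultimately periodic set with period π_X = p^μ·r where μ ≥ λ and p does not divide r. Then every deterministic finite automaton accepting the language rep_U(X) has at least p^{μ−λ+1} states. -/
/-- The language `rep_U(X)`. -/
def repLang (U : ℕ → ℕ) (X : Set ℕ) : Language ℕ :=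
  {w | IsGreedyRep U w ∧ valU U w ∈ X}

/-- Every suffix of `w` satisfies the greedy inequality; leading zeros are allowed. -/
def IsPaddedGreedy (U : ℕ → ℕ) (w : List ℕ) : Prop :=
  ∀ t < w.length, ∑ i ∈ Finset.range (t + 1), w.reverse.getD i 0 * U i < U (t + 1)

lemma sum_range_getD_reverse_cons (U : ℕ → ℕ) (d : ℕ) (w : List ℕ) {t : ℕ} (ht : t ≤ w.length) :
    ∑ i ∈ Finset.range t, (d :: w).reverse.getD i 0 * U i =
      ∑ i ∈ Finset.range t, w.reverse.getD i 0 * U i := by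
  refine Finset.sum_congr rfl fun i hi => ?_
  have hi' : i < w.reverse.length := by
    rw [List.length_reverse]; exact lt_of_lt_of_le (Finset.mem_range.1 hi) ht
  rw [List.reverse_cons, List.getD_append _ _ _ _ hi']

lemma valU_cons (U : ℕ → ℕ) (d : ℕ) (w : List ℕ) :
    valU U (d :: w) = d * U w.length + valU U w := by
  unfold valU
  rw [List.length_cons, Finset.sum_range_succ, sum_range_getD_reverse_cons U d w le_rfl, add_comm]
  congr 2
  rw [List.reverse_cons, List.getD_append_right _ _ _ _ (by simp)]
  simp

lemma IsPaddedGreedy.cons {U : ℕ → ℕ} {d : ℕ} {w : List ℕ} (hw : IsPaddedGreedy U w)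
    (h : valU U (d :: w) < U (w.length + 1)) : IsPaddedGreedy U (d :: w) := by
  intro t ht
  rw [List.length_cons] at ht
  rcases (Nat.lt_succ_iff.1 ht).lt_or_eq with hlt | rfl
  · rw [sum_range_getD_reverse_cons U d w hlt]
    exact hw t hlt
  · exact h

lemma IsPaddedGreedy.valU_lt {U : ℕ → ℕ} (hU : IsNumSys U) {w : List ℕ}
    (hw : IsPaddedGreedy U w) : valU U w < U w.length := by
  cases w with
  | nil => simp [valU, hU.base]
  | cons d w => exact hw w.length (by simp)

lemma isPaddedGreedy_replicate_append {U : ℕ → ℕ} (hU : IsNumSys U) {w : List ℕ}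
    (hw : IsPaddedGreedy U w) (c : ℕ) :
    IsPaddedGreedy U (List.replicate c 0 ++ w) ∧
      valU U (List.replicate c 0 ++ w) = valU U w := by
  induction c with
  | zero => simpa using hw
  | succ c ih =>
    rw [List.replicate_succ, List.cons_append]
    have hval : valU U (0 :: (List.replicate c 0 ++ w)) = valU U w := by
      rw [valU_cons, ih.2]; simp
    refine ⟨ih.1.cons ?_, hval⟩
    rw [valU_cons, zero_mul, zero_add]
    exact (ih.1.valU_lt hU).trans (hU.mono (Nat.lt_succ_self _))

lemma exists_isPaddedGreedy_valU_eq {U : ℕ → ℕ} (hU : IsNumSys U) (L : ℕ) :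
    ∀ n < U L, ∃ s : List ℕ, s.length = L ∧ IsPaddedGreedy U s ∧ valU U s = n := by
  induction L with
  | zero =>
    intro n hn
    rw [hU.base] at hn
    exact ⟨[], rfl, fun t ht => by simp at ht, by simp [valU]; omega⟩
  | succ L ih =>
    intro n hn
    have hpos : 0 < U L := by
      have := hU.mono.monotone (Nat.zero_le L)
      rw [hU.base] at this
      exact this
    obtain ⟨s, hs, hok, hval⟩ := ih (n % U L) (Nat.mod_lt _ hpos)
    have hv : valU U (n / U L :: s) = n := by
      rw [valU_cons, hs, hval]; exact Nat.div_add_mod' n (U L)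
    exact ⟨n / U L :: s, by simp [hs], hok.cons (by rw [hv, hs]; exact hn), hv⟩

/-- `x` is a prefix contributing `V` in front of any padded greedy suffix of length `L`. -/
def IsGreedyPrefix (U : ℕ → ℕ) (L : ℕ) (x : List ℕ) (V : ℕ) : Prop :=
  ∀ s : List ℕ, s.length = L → IsPaddedGreedy U s →
    IsPaddedGreedy U (x ++ s) ∧ valU U (x ++ s) = V + valU U s

lemma IsGreedyPrefix.one_cons {U : ℕ → ℕ} (hU : IsNumSys U) {L V i : ℕ} {x : List ℕ}
    (hx : IsGreedyPrefix U L x V) (hi : x.length + L ≤ i)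
    (hgap : U (x.length + L) ≤ U (i + 1) - U i) :
    IsGreedyPrefix U L (1 :: (List.replicate (i - (x.length + L)) 0 ++ x)) (U i + V) := by
  intro s hs hok
  obtain ⟨h1, h2⟩ := hx s hs hok
  obtain ⟨h3, h4⟩ := isPaddedGreedy_replicate_append hU h1 (i - (x.length + L))
  have hlen : (List.replicate (i - (x.length + L)) 0 ++ (x ++ s)).length = i := by
    simp [hs]; omega
  rw [List.cons_append, List.append_assoc]
  have hv : valU U (1 :: (List.replicate (i - (x.length + L)) 0 ++ (x ++ s))) =
      U i + V + valU U s := by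
    rw [valU_cons, hlen, h4, h2]; ring
  refine ⟨h3.cons ?_, hv⟩
  rw [hv, hlen]
  have h5 := h1.valU_lt hU
  rw [h2, List.length_append, hs] at h5
  omega

lemma GapsUnbounded.eventually_le {U : ℕ → ℕ} (h2 : GapsUnbounded U)
    (h3 : GapsUltNondecreasing U) (B : ℕ) :
    ∃ m, ∀ i ≥ m, B ≤ U (i + 1) - U i := by
  obtain ⟨G, hG⟩ := h3
  obtain ⟨m, hm, hB⟩ := Filter.frequently_atTop.1 (h2 B) G
  refine ⟨m, fun i hi => ?_⟩
  induction i, hi using Nat.le_induction with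
  | base => exact hB
  | succ i hi ih => exact ih.trans (hG i (le_trans hm hi))

lemma exists_infinite_mod_eq {U : ℕ → ℕ} {q n : ℕ} (hqn : q ∣ n) (hn : 0 < n)
    (hinf : {i : ℕ | ¬ q ∣ U i}.Infinite) :
    ∃ u, ¬ q ∣ u ∧ {i | U i ≡ u [MOD n]}.Infinite := by
  by_contra! h
  refine hinf (((Set.finite_lt_nat n).biUnion (t := fun u => {i | ¬ q ∣ u ∧ U i ≡ u [MOD n]})
    fun u _ => ?_).subset fun i hi => ?_)
  · by_cases hu : q ∣ u
    · simp [hu]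
    · exact (h u hu).subset fun i hi => hi.2
  · refine Set.mem_iUnion₂.2 ⟨U i % n, Nat.mod_lt _ hn, ?_, (Nat.mod_modEq _ _).symm⟩
    rwa [Nat.dvd_mod_iff hqn]

lemma exists_isGreedyPrefix {U : ℕ → ℕ} (hU : IsNumSys U) (h2 : GapsUnbounded U)
    (h3 : GapsUltNondecreasing U) {n u : ℕ} (hinf : {i | U i ≡ u [MOD n]}.Infinite)
    (L b j : ℕ) :
    ∃ x V, IsGreedyPrefix U L x V ∧ V ≡ j * u [MOD n] ∧
      (1 ≤ j → x.head? = some 1 ∧ b ≤ V) := by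
  induction j with
  | zero =>
    refine ⟨[], 0, fun s _ hok => ⟨hok, by simp⟩, by rw [zero_mul], by simp⟩
  | succ j ih =>
    obtain ⟨x, V, hx, hV, -⟩ := ih
    obtain ⟨m, hm⟩ := h2.eventually_le h3 (U (x.length + L))
    obtain ⟨i, hi, hlt⟩ := hinf.exists_gt (m + b + (x.length + L))
    refine ⟨_, _, hx.one_cons hU (by omega) (hm i (by omega)), ?_, fun _ => ⟨rfl, ?_⟩⟩
    · rw [add_mul, one_mul, add_comm]
      exact hV.add hi
    · have := hU.mono.id_le i
      simp only [id] at this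
      omega

lemma PeriodFrom.mem_add_mul_iff {X : Set ℕ} {b q : ℕ} (h : PeriodFrom X b q) {n : ℕ}
    (hn : b ≤ n) (t : ℕ) : n ∈ X ↔ n + q * t ∈ X := by
  induction t with
  | zero => simp
  | succ t ih =>
    rw [ih, h (n + q * t) (by omega), mul_add, mul_one, add_assoc]

lemma HasMinPeriod.dvd_s6 {X : Set ℕ} {q D b : ℕ} (hX : HasMinPeriod X q)
    (hD : PeriodFrom X b D) : q ∣ D := by
  obtain ⟨hq, ⟨c, hc⟩, hmin⟩ := hX
  by_contra hnd
  have hmod : D % q ≠ 0 := fun h => hnd (Nat.dvd_of_mod_eq_zero h)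
  have hle := hmin (D % q) (by omega) ⟨b + c, fun n hn => by
    rw [hD n (by omega), hc.mem_add_mul_iff (n := n + D % q) (by omega) (D / q), add_assoc,
      Nat.mod_add_div]⟩
  exact absurd (Nat.mod_lt D hq) (by omega)

lemma HasMinPeriod.modEq_of_forall_lt {X : Set ℕ} {q b V W : ℕ} (hX : HasMinPeriod X q)
    (hb : PeriodFrom X b q) (hV : b ≤ V) (hW : b ≤ W)
    (h : ∀ n < q, (V + n ∈ X ↔ W + n ∈ X)) : V ≡ W [MOD q] := by
  wlog hVW : V ≤ W generalizing V W
  · exact (this hW hV (fun n hn => (h n hn).symm) (by omega)).symm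
  refine (Nat.modEq_iff_dvd' hVW).2 (hX.dvd_s6 (b := V) fun n hn => ?_)
  have hdm := Nat.mod_add_div (n - V) q
  have e1 := hb.mem_add_mul_iff (n := V + (n - V) % q) (by omega) ((n - V) / q)
  have e2 := hb.mem_add_mul_iff (n := W + (n - V) % q) (by omega) ((n - V) / q)
  rw [show V + (n - V) % q + q * ((n - V) / q) = n by omega] at e1
  rw [show W + (n - V) % q + q * ((n - V) / q) = n + (W - V) by omega] at e2
  rw [← e1, ← e2]
  exact h _ (Nat.mod_lt _ hX.1)

lemma Nat.Prime.pow_dvd_left_of_not_pow_dvd {p m l d u : ℕ} (hp : p.Prime)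
    (hlm : l ≤ m) (h : p ^ m ∣ d * u) (hu : ¬ p ^ l ∣ u) : p ^ (m - l + 1) ∣ d := by
  rcases eq_or_ne d 0 with rfl | hd
  · exact dvd_zero _
  have hu0 : u ≠ 0 := by rintro rfl; exact hu (dvd_zero _)
  rw [hp.pow_dvd_iff_le_factorization (mul_ne_zero hd hu0),
    Nat.factorization_mul hd hu0, Finsupp.add_apply] at h
  rw [hp.pow_dvd_iff_le_factorization hu0] at hu
  rw [hp.pow_dvd_iff_le_factorization hd]
  omega

lemma append_mem_repLang_iff {U : ℕ → ℕ} {X : Set ℕ} {L V : ℕ} {x s : List ℕ}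
    (hx : IsGreedyPrefix U L x V) (hhead : x.head? = some 1) (hs : s.length = L)
    (hok : IsPaddedGreedy U s) : x ++ s ∈ repLang U X ↔ V + valU U s ∈ X := by
  obtain ⟨h1, h2⟩ := hx s hs hok
  change IsGreedyRep U (x ++ s) ∧ valU U (x ++ s) ∈ X ↔ _
  rw [h2]
  refine and_iff_right ⟨?_, h1⟩
  rw [List.head?_append, hhead]
  simp

/-- Let `U` be a numeration system satisfying (H1), (H2), (H3), linear
with coefficients `a 0, …, a (k-1)`. Let `p` be a prime not dividing all coefficients and
`λ ≥ 1` with `U i ≢ 0 (mod p^λ)` for infinitely many `i`. If `X` is ultimately periodic of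
period `p^μ * r` with `μ ≥ λ` and `p ∤ r`, then every DFA accepting `rep_U(X)` has at
least `p^(μ-λ+1)` states. -/
theorem stmt6 (U : ℕ → ℕ) (hU : IsNumSys U)
    (h1 : IsRegularLang {w : List ℕ | IsGreedyRep U w})
    (h2 : GapsUnbounded U) (h3 : GapsUltNondecreasing U)
    (k : ℕ) (hk : 1 ≤ k) (a : Fin k → ℤ) (ha0 : a ⟨0, hk⟩ ≠ 0) (N : ℕ)
    (hrec : ∀ i ≥ N, (U (i + k) : ℤ) = ∑ j : Fin k, a j * U (i + (j : ℕ)))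
    (p : ℕ) (hp : p.Prime) (hpa : ¬ ∀ j : Fin k, (p : ℤ) ∣ a j)
    (lam : ℕ) (hlam : 1 ≤ lam) (hinf : {i : ℕ | ¬ p ^ lam ∣ U i}.Infinite)
    (X : Set ℕ) (μ r : ℕ) (hμ : lam ≤ μ) (hr : ¬ p ∣ r)
    (hX : HasMinPeriod X (p ^ μ * r))
    (σ : Type) [Fintype σ] (M : DFA ℕ σ) (hM : M.accepts = repLang U X) :
    p ^ (μ - lam + 1) ≤ Fintype.card σ := by
  have hq : 0 < p ^ μ * r := hX.1
  obtain ⟨u, hu, huinf⟩ :=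
    exists_infinite_mod_eq (dvd_mul_of_dvd_left (pow_dvd_pow p hμ) r) hq hinf
  obtain ⟨b, hb⟩ := hX.2.1
  choose x V hx hV hxV using
    exists_isGreedyPrefix hU h2 h3 huinf (p ^ μ * r) b
  have hinj : Function.Injective
      fun j : Fin (p ^ (μ - lam + 1)) => M.eval (x ((j : ℕ) + 1)) := by
    intro i j hij
    have key : V (i + 1) ≡ V (j + 1) [MOD p ^ μ * r] := by
      refine hX.modEq_of_forall_lt hb (hxV _ (by omega)).2 (hxV _ (by omega)).2 fun n hn => ?_
      obtain ⟨s, hs, hok, rfl⟩ := exists_isPaddedGreedy_valU_eq hU (p ^ μ * r) n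
        (hn.trans_le (hU.mono.id_le _))
      rw [← append_mem_repLang_iff (hx (i + 1)) (hxV _ (by omega)).1 hs hok,
        ← append_mem_repLang_iff (hx (j + 1)) (hxV _ (by omega)).1 hs hok, ← hM,
        DFA.mem_accepts, DFA.mem_accepts, DFA.eval, DFA.evalFrom_of_append,
        DFA.evalFrom_of_append]
      exact iff_of_eq (congrArg (fun q => M.evalFrom q s ∈ M.accept) hij)
    have hmul : ((i : ℕ) + 1) * u ≡ (j + 1) * u [MOD p ^ μ] :=
      (((hV _).symm.trans key).trans (hV _)).of_mul_right r
    wlog hle : (i : ℕ) ≤ j generalizing i j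
    · exact (this hij.symm key.symm hmul.symm (by omega)).symm
    rw [Nat.modEq_iff_dvd' (Nat.mul_le_mul_right u (by omega)), ← Nat.sub_mul] at hmul
    have hdvd := hp.pow_dvd_left_of_not_pow_dvd hμ hmul hu
    have := Nat.eq_zero_of_dvd_of_lt hdvd (by omega)
    exact Fin.ext (by omega)
  simpa using Fintype.card_le_of_injective _ hinj
end

section
/- Let (U_i)_{i≥0} be defined by U_0 = 1, U_1 = 13, U_2 = 163 and U_{i+3} = 12U_{i+2} + 6U_{i+1} + 12U_i for all i ≥ 0. Then for all i ≥ 0, ν_3(U_i) = ⌊i/3⌋ + 1 if i ≡ 4 (mod 9), and ν_3(U_i) = ⌊i/3⌋ if i ≢ 4 (mod 9). -/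
/-- Blocks of three consecutive terms, divided by `3 ^ n`, are periodic modulo `9`. -/
theorem exists_block_mod_nine (U : ℕ → ℕ)
    (h0 : U 0 = 1) (h1 : U 1 = 13) (h2 : U 2 = 163)
    (hrec : ∀ i : ℕ, U (i + 3) = 12 * U (i + 2) + 6 * U (i + 1) + 12 * U i) (n : ℕ) :
    ∃ a b c : ℕ, U (3 * n) = 3 ^ n * a ∧ U (3 * n + 1) = 3 ^ n * b ∧
      U (3 * n + 2) = 3 ^ n * c ∧
      ((n % 9 = 0 ∧ a % 9 = 1 ∧ b % 9 = 4 ∧ c % 9 = 1) ∨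
      (n % 9 = 1 ∧ a % 9 = 7 ∧ b % 9 = 3 ∧ c % 9 = 1) ∨
      (n % 9 = 2 ∧ a % 9 = 2 ∧ b % 9 = 2 ∧ c % 9 = 4) ∨
      (n % 9 = 3 ∧ a % 9 = 1 ∧ b % 9 = 1 ∧ c % 9 = 7) ∨
      (n % 9 = 4 ∧ a % 9 = 7 ∧ b % 9 = 3 ∧ c % 9 = 7) ∨
      (n % 9 = 5 ∧ a % 9 = 8 ∧ b % 9 = 5 ∧ c % 9 = 1) ∨
      (n % 9 = 6 ∧ a % 9 = 1 ∧ b % 9 = 7 ∧ c % 9 = 4) ∨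
      (n % 9 = 7 ∧ a % 9 = 7 ∧ b % 9 = 3 ∧ c % 9 = 4) ∨
      (n % 9 = 8 ∧ a % 9 = 5 ∧ b % 9 = 8 ∧ c % 9 = 7)) := by
  induction n with
  | zero => exact ⟨1, 13, 163, by simp [h0], by simp [h1], by simp [h2], by simp⟩
  | succ n ih =>
    obtain ⟨a, b, c, ha, hb, hc, h⟩ := ih
    have ha' : U (3 * n + 3) = 3 ^ (n + 1) * (4 * c + 2 * b + 4 * a) := by
      rw [hrec, ha, hb, hc]; ring
    have hb' : U (3 * n + 4) = 3 ^ (n + 1) * (12 * (4 * c + 2 * b + 4 * a) + 2 * c + 4 * b) := by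
      rw [hrec (3 * n + 1), ha', hb, hc]; ring
    have hc' : U (3 * n + 5) = 3 ^ (n + 1) *
        (12 * (12 * (4 * c + 2 * b + 4 * a) + 2 * c + 4 * b) +
          6 * (4 * c + 2 * b + 4 * a) + 4 * c) := by
      rw [hrec (3 * n + 2), hb', ha', hc]; ring
    refine ⟨_, _, _, ha', hb', hc', ?_⟩
    rcases h with h | h | h | h | h | h | h | h | h <;> simp [Nat.add_mod, Nat.mul_mod, h]

theorem padicValNat_three_pow_mul (n a : ℕ) (ha : ¬ 3 ∣ a) :
    padicValNat 3 (3 ^ n * a) = n := by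
  have : Fact (Nat.Prime 3) := ⟨Nat.prime_three⟩
  have ha0 : a ≠ 0 := by rintro rfl; simp at ha
  rw [padicValNat.mul (by positivity) ha0, padicValNat.prime_pow,
    padicValNat.eq_zero_of_not_dvd ha, add_zero]


/-- For the sequence `U 0 = 1, U 1 = 13, U 2 = 163`,
`U (i+3) = 12 U (i+2) + 6 U (i+1) + 12 U i`, the 3-adic valuation of `U i` equals
`⌊i/3⌋ + 1` if `i ≡ 4 (mod 9)` and `⌊i/3⌋` otherwise. -/
theorem stmt11 (U : ℕ → ℕ)
    (h0 : U 0 = 1) (h1 : U 1 = 13) (h2 : U 2 = 163)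
    (hrec : ∀ i : ℕ, U (i + 3) = 12 * U (i + 2) + 6 * U (i + 1) + 12 * U i) :
    ∀ i : ℕ, padicValNat 3 (U i) = i / 3 + (if i % 9 = 4 then 1 else 0) := by
  intro i
  obtain ⟨a, b, c, ha, hb, hc, h⟩ := exists_block_mod_nine U h0 h1 h2 hrec (i / 3)
  have hi : i = 3 * (i / 3) ∨ i = 3 * (i / 3) + 1 ∨ i = 3 * (i / 3) + 2 := by omega
  by_cases h4 : i % 9 = 4
  · have hU : U i = 3 ^ (i / 3 + 1) * (b / 3) := by
      rw [show U i = U (3 * (i / 3) + 1) from congrArg U (by omega), hb, pow_succ, mul_assoc,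
        show 3 * (b / 3) = b by omega]
    rw [hU, padicValNat_three_pow_mul _ _ (by omega), if_pos h4]
  · rw [if_neg h4, add_zero]
    rcases hi with hi | hi | hi
    · rw [show U i = _ from (congrArg U hi).trans ha, padicValNat_three_pow_mul _ _ (by omega)]
    · rw [show U i = _ from (congrArg U hi).trans hb, padicValNat_three_pow_mul _ _ (by omega)]
    · rw [show U i = _ from (congrArg U hi).trans hc, padicValNat_three_pow_mul _ _ (by omega)]
end

section
/- Let p be a prime and let ζ ∈ ℤ_p be a p-adic integer that is not equal to any natural number. For a ≥ 0, let ζ_a be the unique natural number with 0 ≤ ζ_a < p^a and ζ ≡ ζ_a (mod p^a), and set ℓ_ζ(a) = ν_p(ζ − ζ_a) − a (the length of the block of zero base-p digits of ζ starting at position a). Suppose C and D are real numbers with C > 0 and D ≥ −(C + 1) such that ℓ_ζ(a) ≤ C·a + D for all a ≥ 2. Then for every natural number n ≥ p, ν_p(n − ζ) ≤ ((2C + D + 2)/log(p))·log(n). -/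
/-- A natural number below `p ^ a` that is congruent to `ζ` modulo `p ^ a` is `ζ.appr a`. -/
theorem PadicInt.eq_appr_of_dvd {p : ℕ} [Fact p.Prime] {ζ : ℤ_[p]} {a n : ℕ}
    (hn : n < p ^ a) (h : (p : ℤ_[p]) ^ a ∣ (n : ℤ_[p]) - ζ) : n = ζ.appr a := by
  have h₁ : (p : ℤ_[p]) ^ a ∣ ζ - (ζ.appr a : ℤ_[p]) :=
    Ideal.mem_span_singleton.mp (PadicInt.appr_spec a ζ)
  have h₂ : (p : ℤ_[p]) ^ a ∣ (((n : ℤ) - (ζ.appr a : ℤ) : ℤ) : ℤ_[p]) := by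
    have h₃ := dvd_add h h₁
    rw [sub_add_sub_cancel] at h₃
    exact_mod_cast h₃
  rw [PadicInt.pow_p_dvd_int_iff] at h₂
  have h₄ : ζ.appr a ≡ n [MOD p ^ a] := (Nat.modEq_iff_dvd).mpr (by exact_mod_cast h₂)
  exact (h₄.eq_of_lt_of_lt (PadicInt.appr_lt ζ a) hn).symm


/-- Let `ζ ∈ ℤ_p` not be a natural number; `ζ.appr a` is the unique
natural number `< p^a` congruent to `ζ` mod `p^a`, and `ν_p(ζ - ζ.appr a) - a` is the
length of the block of zero base-`p` digits of `ζ` starting at position `a`. If these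
block lengths satisfy `ℓ_ζ(a) ≤ C a + D` for all `a ≥ 2`, with `C > 0` and
`D ≥ -(C+1)`, then `ν_p(n - ζ) ≤ ((2C + D + 2) / log p) * log n` for every natural
`n ≥ p`. -/
theorem stmt12 (p : ℕ) [hp : Fact p.Prime] (ζ : ℤ_[p])
    (hζ : ∀ n : ℕ, ζ ≠ (n : ℤ_[p]))
    (C D : ℝ) (hC : 0 < C) (hD : -(C + 1) ≤ D)
    (hblock : ∀ a : ℕ, 2 ≤ a →
      ((ζ - (ζ.appr a : ℤ_[p])).valuation : ℝ) - (a : ℝ) ≤ C * a + D) :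
    ∀ n : ℕ, p ≤ n →
      (((n : ℤ_[p]) - ζ).valuation : ℝ) ≤
        ((2 * C + D + 2) / Real.log p) * Real.log n := by
  intro n hn
  have hp1 : 1 < p := hp.out.one_lt
  have hn0 : n ≠ 0 := by omega
  set k := Nat.log p n with hk
  have hk1 : 1 ≤ k := Nat.log_pos hp1 hn
  have hlt : n < p ^ (k + 1) := Nat.lt_pow_succ_log_self hp1 n
  have hlogp : 0 < Real.log p := Real.log_pos (by exact_mod_cast hp1)
  have hklog : (k : ℝ) ≤ Real.log n / Real.log p := by
    rw [le_div_iff₀ hlogp, ← Real.log_pow]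
    have hpk : 0 < p ^ k := pow_pos (by omega) k
    exact Real.log_le_log (by exact_mod_cast hpk)
      (by exact_mod_cast Nat.pow_log_le_self p hn0)
  have hk1' : (1 : ℝ) ≤ k := by exact_mod_cast hk1
  suffices h : (((n : ℤ_[p]) - ζ).valuation : ℝ) ≤ (2 * C + D + 2) * k by
    refine h.trans ?_
    rw [div_mul_eq_mul_div, mul_div_assoc]
    exact mul_le_mul_of_nonneg_left hklog (by linarith)
  have hne : (n : ℤ_[p]) - ζ ≠ 0 := sub_ne_zero.mpr (hζ n).symm
  by_cases hv : k + 1 ≤ ((n : ℤ_[p]) - ζ).valuation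
  · have hdvd : (p : ℤ_[p]) ^ (k + 1) ∣ (n : ℤ_[p]) - ζ := by
      rw [← Ideal.mem_span_singleton]
      exact (PadicInt.mem_span_pow_iff_le_valuation _ hne _).mpr hv
    have hb := hblock (k + 1) (by omega)
    rw [← PadicInt.eq_appr_of_dvd hlt hdvd] at hb
    have hsymm : (ζ - (n : ℤ_[p])).valuation = ((n : ℤ_[p]) - ζ).valuation := by
      have hnorm := norm_sub_rev ζ (n : ℤ_[p])
      rw [PadicInt.norm_eq_zpow_neg_valuation hne,
        PadicInt.norm_eq_zpow_neg_valuation (sub_ne_zero.mpr (hζ n))] at hnorm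
      have := zpow_right_injective₀ (a := (p : ℝ)) (by positivity)
        (by exact_mod_cast hp1.ne') hnorm
      omega
    rw [hsymm] at hb
    push_cast at hb
    nlinarith [mul_nonneg (sub_nonneg.mpr hk1') (by linarith : 0 ≤ C + 1 + D)]
  · have hv' : (((n : ℤ_[p]) - ζ).valuation : ℝ) ≤ k := by
      exact_mod_cast (by omega : ((n : ℤ_[p]) - ζ).valuation ≤ k)
    nlinarith
end

section
/- Let (U_i)_{i≥0} be defined by U_0 = 1, U_1 = 13, U_2 = 163 and U_{i+3} = 12U_{i+2} + 6U_{i+1} + 12U_i for all i ≥ 0. There exists a unique ζ ∈ ℤ_2 with the following property: for every sequence (i_n)_{n≥0} of natural numbers such that the real sequence ν_2(U_{i_n}) − i_n/2 tends to +∞, the sequence (i_n)_{n≥0}, viewed as a sequence in ℤ_2, converges to ζ. -/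
namespace PadicInt

theorem odd_iff_isUnit {x : ℤ_[2]} : Odd x ↔ IsUnit x := by
  have h2 : ∀ y : ℤ_[2], ¬ IsUnit (2 * y) := fun y h =>
    (prime_p (p := 2)).not_isUnit (by exact_mod_cast isUnit_of_mul_isUnit_left h)
  obtain ⟨n, hn, hx⟩ := exists_mem_range x
  rw [maximalIdeal_eq_span_p, Ideal.mem_span_singleton] at hx
  obtain ⟨y, hy⟩ := hx
  push_cast at hy
  interval_cases n
  · have hx : x = 2 * y := by simpa using hy
    refine ⟨?_, fun h => absurd (hx ▸ h) (h2 y)⟩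
    rintro ⟨z, hz⟩
    exact absurd (by convert isUnit_one using 1; linear_combination hz - hx) (h2 (y - z))
  · have hx : x = 2 * y + 1 := by push_cast at hy; linear_combination hy
    refine ⟨fun _ => ?_, fun _ => ⟨y, hx⟩⟩
    by_contra h
    have h' : ‖x‖ < 1 := lt_of_le_of_ne (norm_le_one x) (mt isUnit_iff.mpr h)
    obtain ⟨z, hz⟩ := (norm_lt_one_iff_dvd x).mp h'
    push_cast at hz
    exact absurd (by convert isUnit_one using 1; linear_combination hx - hz) (h2 (z - y))

theorem not_odd_two_mul (x : ℤ_[2]) : ¬ Odd (2 * x) := fun h =>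
  (prime_p (p := 2)).not_isUnit (by exact_mod_cast isUnit_of_mul_isUnit_left (odd_iff_isUnit.mp h))

theorem even_or_odd' (x : ℤ_[2]) : Even x ∨ Odd x := by
  by_cases h : IsUnit x
  · exact Or.inr (odd_iff_isUnit.mpr h)
  · left
    have h' : ‖x‖ < 1 := lt_of_le_of_ne (norm_le_one x) (mt isUnit_iff.mpr h)
    exact even_iff_two_dvd.mpr (by exact_mod_cast (norm_lt_one_iff_dvd x).mp h')

theorem two_pow_dvd_natCast {n a : ℕ} : (2 : ℤ_[2]) ^ n ∣ (a : ℤ_[2]) ↔ 2 ^ n ∣ a := by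
  have := pow_p_dvd_int_iff (p := 2) n a
  push_cast at this
  rw [this]
  exact_mod_cast Iff.rfl

/-- A root of `2 X ^ 3 - 12 X ^ 2 - 3 X - 3`, obtained by Hensel lifting. -/
theorem exists_root : ∃ t : ℤ_[2],
    2 * (1 + 8 * t) ^ 3 - 12 * (1 + 8 * t) ^ 2 - 3 * (1 + 8 * t) - 3 = 0 := by
  open Polynomial in
  let F : ℤ_[2][X] := 2 * X ^ 3 - 12 * X ^ 2 - 3 * X - 3
  have hF : ∀ z : ℤ_[2], F.aeval z = 2 * z ^ 3 - 12 * z ^ 2 - 3 * z - 3 := fun z => by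
    simp [F]
  have hF' : F.derivative.aeval (1 : ℤ_[2]) = -21 := by
    simp [F]; norm_num
  have hn : ‖(-21 : ℤ_[2])‖ = 1 :=
    isUnit_iff.mp (odd_iff_isUnit.mp ⟨-11, by norm_num⟩)
  have h16 : ‖(-16 : ℤ_[2])‖ < 1 :=
    (norm_lt_one_iff_dvd _).mpr ⟨-8, by norm_num⟩
  obtain ⟨z, hz, hz1, -⟩ := hensels_lemma (F := F) (a := (1 : ℤ_[2])) (by
    rw [hF', hn, hF]; norm_num; simpa using h16)
  rw [hF', hn, norm_lt_one_iff_dvd] at hz1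
  obtain ⟨w, hw⟩ := hz1
  rw [hF] at hz
  push_cast at hw
  obtain rfl : z = 1 + 2 * w := by linear_combination hw
  refine ⟨(1 + 2 * w) * w * (w + 1) - 6 * w * (w + 1) - 2, ?_⟩
  have : 1 + 8 * ((1 + 2 * w) * w * (w + 1) - 6 * w * (w + 1) - 2) = 1 + 2 * w := by
    linear_combination hz
  rwa [this]

end PadicInt

section Ring

variable {A : Type*} [Ring A]

theorem one_add_eight_mul_pow_of_odd (θ : A) {u : ℕ} (hu : Odd u) :
    ∃ η : A, (1 + 8 * θ) ^ u = 1 + 8 * (θ + 2 * η) := by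
  obtain ⟨k, rfl⟩ := hu
  induction k with
  | zero => exact ⟨0, by simp⟩
  | succ k ih =>
    obtain ⟨η, h⟩ := ih
    refine ⟨η + (1 + 8 * (θ + 2 * η)) * (θ + 4 * θ * θ), ?_⟩
    rw [show 2 * (k + 1) + 1 = 2 * k + 1 + 2 by ring, pow_add, h]
    noncomm_ring

theorem one_add_eight_mul_pow (θ : A) {u : ℕ} (hu : Odd u) (n : ℕ) :
    ∃ η : A, (1 + 8 * θ) ^ (2 ^ n * u) = 1 + 2 ^ (n + 3) * (θ + 2 * η) := by
  induction n with
  | zero =>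
    obtain ⟨η, h⟩ := one_add_eight_mul_pow_of_odd θ hu
    exact ⟨η, by rw [pow_zero, one_mul, h]; norm_num⟩
  | succ n ih =>
    obtain ⟨η, h⟩ := ih
    refine ⟨η + 2 ^ (n + 1) * (θ + 2 * η) ^ 2, ?_⟩
    have hc : Commute (θ + 2 * η) ((2 : A) ^ (n + 3)) :=
      ((Nat.cast_commute 2 (θ + 2 * η)).symm.pow_right _)
    have hsq : (2 ^ (n + 3) * (θ + 2 * η)) ^ 2
        = 2 ^ (n + 4) * (2 * (2 ^ (n + 1) * (θ + 2 * η) ^ 2)) := by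
      rw [hc.symm.mul_pow, ← pow_mul, ← mul_assoc, ← mul_assoc, ← pow_succ, ← pow_add]
      congr 2; ring
    rw [show 2 ^ (n + 1) * u = 2 ^ n * u * 2 by ring, pow_mul, h,
      show (1 + 2 ^ (n + 3) * (θ + 2 * η)) ^ 2 = 1 + 2 ^ (n + 3) * 2 * (θ + 2 * η) +
        (2 ^ (n + 3) * (θ + 2 * η)) ^ 2 by noncomm_ring, hsq, ← pow_succ]
    noncomm_ring

end Ring

section Shift

variable {R : Type*} [CommRing R]

/-- The shift `(x₀, x₁) ↦ (x₁, x₂)` on consecutive terms of the recurrence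
`xₖ₊₂ = s xₖ₊₁ - r xₖ`. -/
def recShift (s r : R) : Module.End R (R × R) :=
  (LinearMap.snd R R R).prod (s • LinearMap.snd R R R - r • LinearMap.fst R R R)

@[simp]
theorem recShift_apply (s r : R) (v : R × R) :
    recShift s r v = (v.2, s * v.2 - r * v.1) := rfl

theorem recShift_pow_succ_fst (s r : R) (v : R × R) (k : ℕ) :
    ((recShift s r ^ (k + 1)) v).1 = ((recShift s r ^ k) v).2 := by
  rw [pow_succ', Module.End.mul_apply, recShift_apply]

theorem recShift_pow_four (σ ρ : R) :
    recShift (4 * σ) (1 + 8 * ρ) ^ 4 = 1 + 8 *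
      ((8 * σ ^ 3 - (1 + 8 * ρ) * σ) • recShift (4 * σ) (1 + 8 * ρ) +
        (2 * (ρ + 4 * ρ ^ 2 - (1 + 8 * ρ) * σ ^ 2)) • 1) := by
  refine LinearMap.ext fun v => ?_
  have h8 : ∀ w : R × R, (8 : Module.End R (R × R)) w = (8 : R) • w := fun w => by
    rw [← Nat.cast_ofNat, Module.End.natCast_apply, ← Nat.cast_smul_eq_nsmul R, Nat.cast_ofNat]
  simp only [pow_succ, pow_zero, one_mul, Module.End.mul_apply, LinearMap.add_apply, h8,
    LinearMap.smul_apply, Module.End.one_apply, recShift_apply]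
  ext <;> simp <;> ring

/-- If `W` satisfies a second order recurrence, then so do its terms of a fixed parity, after
rescaling. -/
theorem recShift_pow_eq {W : ℕ → R} {p q s r : R} (hs : p ^ 2 - 2 * q = 2 * s)
    (hr : q ^ 2 = 4 * r) (hW : ∀ i, W (i + 2) = p * W (i + 1) - q * W i) (j l : ℕ)
    (x y : R) (hx : W j = 2 ^ l * x) (hy : W (j + 2) = 2 ^ (l + 1) * y) (k : ℕ) :
    W (2 * k + j) = 2 ^ (k + l) * ((recShift s r ^ k) (x, y)).1 ∧
      W (2 * k + j + 2) = 2 ^ (k + l + 1) * ((recShift s r ^ k) (x, y)).2 := by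
  induction k with
  | zero => simpa using ⟨hx, hy⟩
  | succ k ih =>
    obtain ⟨h1, h2⟩ := ih
    have e : 2 * (k + 1) + j = 2 * k + j + 2 := by ring
    rw [recShift_pow_succ_fst, e, pow_succ' (recShift s r) k, Module.End.mul_apply, recShift_apply]
    refine ⟨by rw [h2]; ring, ?_⟩
    have h3 : W (2 * k + j + 2 + 2) = 2 * s * W (2 * k + j + 2) - 4 * r * W (2 * k + j) := by
      rw [← hs, ← hr, hW (2 * k + j + 2), show 2 * k + j + 2 + 1 = 2 * k + j + 1 + 2 by ring,
        hW (2 * k + j + 1), show 2 * k + j + 1 + 1 = 2 * k + j + 2 by ring, hW (2 * k + j)]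
      ring
    rw [h3, h1, h2]
    ring

theorem even_four_mul (x : R) : Even (4 * x) := ⟨2 * x, by ring⟩

theorem odd_one_add_eight_mul (x : R) : Odd (1 + 8 * x) := ⟨4 * x, by ring⟩

theorem odd_recShift_pow {σ ρ : R} {v : R × R} (h1 : Odd v.1) (h2 : Odd v.2) (k : ℕ) :
    Odd ((recShift (4 * σ) (1 + 8 * ρ) ^ k) v).1 ∧
      Odd ((recShift (4 * σ) (1 + 8 * ρ) ^ k) v).2 := by
  induction k with
  | zero => exact ⟨h1, h2⟩
  | succ k ih =>
    rw [pow_succ', Module.End.mul_apply, recShift_apply]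
    exact ⟨ih.2, ((even_four_mul σ).mul_right _).sub_odd ((odd_one_add_eight_mul ρ).mul ih.1)⟩

theorem even_odd_recShift_pow {σ ρ : R} {v : R × R} (h1 : Even v.1) (h2 : Odd v.2) (k : ℕ) :
    Even ((recShift (4 * σ) (1 + 8 * ρ) ^ (2 * k)) v).1 ∧
      Odd ((recShift (4 * σ) (1 + 8 * ρ) ^ (2 * k)) v).2 := by
  induction k with
  | zero => exact ⟨h1, h2⟩
  | succ k ih =>
    rw [show 2 * (k + 1) = 1 + (1 + 2 * k) by ring, pow_add, pow_add, pow_one,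
      Module.End.mul_apply, Module.End.mul_apply, recShift_apply, recShift_apply]
    refine ⟨((even_four_mul σ).mul_right _).sub (ih.1.mul_left _), ?_⟩
    exact (((even_four_mul σ).mul_right _)).sub_odd ((odd_one_add_eight_mul ρ).mul ih.2)

/-- Moving by `4 m` steps changes an even term by exactly `8 m`, up to an odd factor. -/
theorem recShift_pow_four_mul {σ ρ : R} (hσ : Odd σ) {v : R × R} (h1 : Even v.1) (h2 : Odd v.2)
    {u : ℕ} (hu : Odd u) (n : ℕ) :
    ∃ w, Odd w ∧
      ((recShift (4 * σ) (1 + 8 * ρ) ^ (4 * (2 ^ n * u))) v).1 = v.1 + 2 ^ (n + 3) * w := by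
  obtain ⟨η, h⟩ := one_add_eight_mul_pow
    ((8 * σ ^ 3 - (1 + 8 * ρ) * σ) • recShift (4 * σ) (1 + 8 * ρ) +
        (2 * (ρ + 4 * ρ ^ 2 - (1 + 8 * ρ) * σ ^ 2)) • 1) hu n
  rw [pow_mul, recShift_pow_four, h]
  refine ⟨(8 * σ ^ 3 - (1 + 8 * ρ) * σ) * v.2 +
      2 * (ρ + 4 * ρ ^ 2 - (1 + 8 * ρ) * σ ^ 2) * v.1 + 2 * (η v).1, ?_, ?_⟩
  · refine Odd.add_even (Odd.add_even (Odd.mul (Even.sub_odd ?_ ?_) h2) (h1.mul_left _))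
      (even_two_mul _)
    · exact ⟨4 * σ ^ 3, by ring⟩
    · exact (odd_one_add_eight_mul ρ).mul hσ
  · have hn : ∀ (m : ℕ) (w : R × R),
        ((2 : Module.End R (R × R)) ^ m) w = (2 : R) ^ m • w := fun m w => by
      rw [← Nat.cast_ofNat, ← Nat.cast_pow, Module.End.natCast_apply, ← Nat.cast_smul_eq_nsmul R,
        Nat.cast_pow, Nat.cast_ofNat]
    have hn1 := hn 1
    simp only [pow_one] at hn1
    simp only [Module.End.mul_apply, LinearMap.add_apply, hn, hn1,
      LinearMap.smul_apply, Module.End.one_apply, recShift_apply]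
    simp
    ring

end Shift

section Zeros

variable {σ ρ : ℤ_[2]} {v : ℤ_[2] × ℤ_[2]}

theorem dvd_recShift_pow_four_mul_sub (hσ : Odd σ) (h1 : Even v.1) (h2 : Odd v.2) (m : ℕ) :
    8 ∣ ((recShift (4 * σ) (1 + 8 * ρ) ^ (4 * m)) v).1 - v.1 := by
  rcases eq_or_ne m 0 with rfl | hm
  · simp
  · obtain ⟨n, u, hu, rfl⟩ := Nat.exists_eq_two_pow_mul_odd hm
    obtain ⟨w, -, h⟩ := recShift_pow_four_mul (ρ := ρ) hσ h1 h2 hu n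
    exact ⟨2 ^ n * w, by rw [h]; ring⟩

theorem four_dvd_of_eight_dvd_recShift_pow (hσ : Odd σ) (h1 : 8 ∣ v.1) (h2 : Odd v.2) {k : ℕ}
    (hk : 8 ∣ ((recShift (4 * σ) (1 + 8 * ρ) ^ k) v).1) : 4 ∣ k := by
  have he : Even v.1 := even_iff_two_dvd.mpr (dvd_trans ⟨4, by norm_num⟩ h1)
  obtain ⟨j, rfl | rfl⟩ := Nat.even_or_odd' k
  · obtain ⟨m, rfl | rfl⟩ := Nat.even_or_odd' j
    · exact ⟨m, by ring⟩
    · exfalso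
      have hv := even_odd_recShift_pow (σ := σ) (ρ := ρ) he h2 1
      have := dvd_recShift_pow_four_mul_sub (ρ := ρ) hσ hv.1 hv.2 m
      rw [← Module.End.mul_apply, ← pow_add,
        show 4 * m + 2 * 1 = 2 * (2 * m + 1) by ring, dvd_sub_right hk] at this
      rw [mul_one, pow_two, Module.End.mul_apply, recShift_apply, recShift_apply,
        dvd_sub_left (h1.mul_left _)] at this
      obtain ⟨c, hc⟩ := this
      have hc' : σ * v.2 = 2 * c :=
        mul_left_cancel₀ (by norm_num : (4 : ℤ_[2]) ≠ 0) (by rw [← mul_assoc, hc]; ring)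
      exact PadicInt.not_odd_two_mul c (hc' ▸ hσ.mul h2)
  · exfalso
    rw [recShift_pow_succ_fst] at hk
    obtain ⟨c, hc⟩ := hk
    refine PadicInt.not_odd_two_mul (4 * c) ?_
    rw [show 2 * (4 * c) = 8 * c by ring, ← hc]
    exact (even_odd_recShift_pow he h2 j).2

theorem modEq_of_two_pow_dvd_recShift_pow (hσ : Odd σ) (h1 : Even v.1) (h2 : Odd v.2)
    {N m m' : ℕ} (hm : 2 ^ (N + 3) ∣ ((recShift (4 * σ) (1 + 8 * ρ) ^ (4 * m)) v).1)
    (hm' : 2 ^ (N + 3) ∣ ((recShift (4 * σ) (1 + 8 * ρ) ^ (4 * m')) v).1) :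
    m ≡ m' [MOD 2 ^ N] := by
  wlog hle : m ≤ m' generalizing m m'
  · exact (this hm' hm (le_of_not_ge hle)).symm
  obtain ⟨d, rfl⟩ := Nat.exists_eq_add_of_le hle
  rcases eq_or_ne d 0 with rfl | hd
  · rfl
  obtain ⟨n, u, hu, rfl⟩ := Nat.exists_eq_two_pow_mul_odd hd
  have hv := even_odd_recShift_pow (σ := σ) (ρ := ρ) h1 h2 (2 * m)
  rw [show 2 * (2 * m) = 4 * m by ring] at hv
  obtain ⟨w, hw, h⟩ := recShift_pow_four_mul (ρ := ρ) hσ hv.1 hv.2 hu n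
  rw [← Module.End.mul_apply, ← pow_add,
    show 4 * (2 ^ n * u) + 4 * m = 4 * (m + 2 ^ n * u) by ring] at h
  rw [h, dvd_add_right (by simpa using hm)] at hm'
  have hN : N ≤ n := by
    by_contra! hlt
    obtain ⟨c, hc⟩ := (pow_dvd_pow (2 : ℤ_[2]) (by omega : n + 3 + 1 ≤ N + 3)).trans hm'
    rw [pow_succ 2 (n + 3), mul_assoc] at hc
    have hw' : w = 2 * c := mul_left_cancel₀ (pow_ne_zero _ two_ne_zero) hc
    exact PadicInt.not_odd_two_mul c (hw' ▸ hw)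
  exact (Nat.modEq_iff_dvd' hle).mpr
    (by simpa using (pow_dvd_pow 2 hN).mul_right u)

theorem exists_two_pow_dvd_recShift_pow (hσ : Odd σ) (h1 : 8 ∣ v.1) (h2 : Odd v.2) (N : ℕ) :
    ∃ m ≥ N, 2 ^ (N + 3) ∣ ((recShift (4 * σ) (1 + 8 * ρ) ^ (4 * m)) v).1 := by
  have he : Even v.1 := even_iff_two_dvd.mpr (dvd_trans ⟨4, by norm_num⟩ h1)
  induction N with
  | zero => exact ⟨0, le_rfl, by norm_num; simpa using h1⟩
  | succ N ih =>
    obtain ⟨m, hm, c, hc⟩ := ih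
    have hv := even_odd_recShift_pow (σ := σ) (ρ := ρ) he h2 (2 * m)
    rw [show 2 * (2 * m) = 4 * m by ring] at hv
    have key : ∀ n, ∃ w, Odd w ∧ ((recShift (4 * σ) (1 + 8 * ρ) ^ (4 * (m + 2 ^ n))) v).1 =
        2 ^ (N + 3) * c + 2 ^ (n + 3) * w := fun n => by
      obtain ⟨w, hw, h⟩ := recShift_pow_four_mul (ρ := ρ) hσ hv.1 hv.2 odd_one n
      rw [← Module.End.mul_apply, ← pow_add,
        show 4 * (2 ^ n * 1) + 4 * m = 4 * (m + 2 ^ n) by ring, hc] at h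
      exact ⟨w, hw, h⟩
    rcases PadicInt.even_or_odd' c with ⟨b, hb⟩ | hc'
    · obtain ⟨w, -, h⟩ := key (N + 1)
      exact ⟨m + 2 ^ (N + 1), by have := Nat.one_le_two_pow (n := N + 1); omega, b + w,
        by rw [h, hb]; ring⟩
    · obtain ⟨w, hw, h⟩ := key N
      obtain ⟨b, hb⟩ := hc'.add_odd hw
      exact ⟨m + 2 ^ N, by have := Nat.one_le_two_pow (n := N); omega, b,
        by rw [h, ← mul_add, hb]; ring⟩

end Zeros

theorem exists_eq_recShift_pow {U : ℕ → ℕ}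
    (h0 : U 0 = 1) (h1 : U 1 = 13) (h2 : U 2 = 163)
    (hrec : ∀ i : ℕ, U (i + 3) = 12 * U (i + 2) + 6 * U (i + 1) + 12 * U i) :
    ∃ (σ ρ : ℤ_[2]) (y z : ℤ_[2] × ℤ_[2]), Odd σ ∧ 8 ∣ y.1 ∧ Odd y.2 ∧ Odd z.1 ∧ Odd z.2 ∧
      ∀ k, 2 ^ (2 * k) ∣ (U (2 * k + 1) : ℤ_[2]) -
          2 ^ k * ((recShift (4 * σ) (1 + 8 * ρ) ^ k) y).1 ∧
        2 ^ (2 * k) ∣ 2 * (U (2 * k) : ℤ_[2]) -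
          2 ^ k * ((recShift (4 * σ) (1 + 8 * ρ) ^ k) z).1 := by
  obtain ⟨t, ht⟩ := PadicInt.exists_root
  obtain ⟨a, ha⟩ : ∃ a : ℤ_[2], a = 1 + 8 * t := ⟨_, rfl⟩
  obtain ⟨b, hb⟩ : ∃ b : ℤ_[2], b = 2 * a ^ 2 - 12 * a - 3 := ⟨_, rfl⟩
  rw [← ha] at ht
  have hab : a * b = 3 := by rw [hb]; linear_combination ht
  obtain ⟨δ, hδ⟩ : ∃ δ : ℤ_[2], δ = 6 * a ^ 2 - 24 * a - 3 := ⟨_, rfl⟩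
  have hδu : IsUnit δ := PadicInt.odd_iff_isUnit.mp
    ⟨3 * a ^ 2 - 12 * a - 2, by rw [hδ]; ring⟩
  obtain ⟨A, hA⟩ : δ ∣ 4 * a ^ 2 + 2 * a + 1 := hδu.dvd
  have hAo : Odd A := by
    rw [PadicInt.odd_iff_isUnit]
    exact isUnit_of_mul_isUnit_right (x := δ) (hA.symm ▸ PadicInt.odd_iff_isUnit.mp
      ⟨2 * a ^ 2 + a, by ring⟩)
  have hc : ∀ i, (U (i + 3) : ℤ_[2]) = 12 * U (i + 2) + 6 * U (i + 1) + 12 * U i := fun i => by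
    exact_mod_cast hrec i
  have h3 : U 3 = 2046 := by rw [hrec 0, h0, h1, h2]
  obtain ⟨W, hWdef⟩ : ∃ W : ℕ → ℤ_[2], ∀ i, W i = 2 * U i - A * (2 * a) ^ i := ⟨_, fun _ => rfl⟩
  have hW : ∀ i, W (i + 2) = (12 - 2 * a) * W (i + 1) - (2 * b) * W i := by
    intro i
    induction i with
    | zero =>
      simp only [hWdef, zero_add, h0, h1, h2]
      push_cast
      linear_combination 2 * hA + 2 * (2 - A) * hb + 2 * A * hδ
    | succ i ih =>
      rw [show i + 1 + 2 = i + 3 by ring, show i + 1 + 1 = i + 2 by ring]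
      simp only [hWdef, hc i] at ih ⊢
      linear_combination 2 * a * ih + 2 * (2 * U (i + 1) - A * (2 * a) ^ (i + 1)) * hb -
        4 * (2 * U i - A * (2 * a) ^ i) * hab - 4 * A * (2 * a) ^ i * ht
  obtain ⟨σ, hσ⟩ : ∃ σ : ℤ_[2], σ = 19 - 8 * t - 32 * t ^ 2 := ⟨_, rfl⟩
  obtain ⟨ρ, hρ⟩ : ∃ ρ : ℤ_[2], 1 + 8 * ρ = b ^ 2 :=
    ⟨21 - 208 * (-t + 2 * t ^ 2) + 512 * (-t + 2 * t ^ 2) ^ 2, by rw [hb, ha]; ring⟩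
  have hs : (12 - 2 * a) ^ 2 - 2 * (2 * b) = 2 * (4 * σ) := by
    rw [hσ, hb, ha]; ring
  have hr : (2 * b) ^ 2 = 4 * (1 + 8 * ρ) := by rw [hρ]; ring
  refine ⟨σ, ρ, (13 - A * a, 1023 - 2 * A * a ^ 3), (2 - A, 163 - 2 * A * a ^ 2),
    ⟨9 - 4 * t - 16 * t ^ 2, by rw [hσ]; ring⟩, ?_, ⟨511 - A * a ^ 3, by ring⟩,
    even_two.sub_odd hAo, ⟨81 - A * a ^ 2, by ring⟩, fun k => ⟨?_, ?_⟩⟩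
  · rw [← hδu.dvd_mul_left (u := δ)]
    exact ⟨-35 - 173 * t + 512 * t ^ 2 - 256 * t ^ 3, by
      rw [mul_sub, ← mul_assoc, ← hA, hδ, ha]; ring⟩
  · have := (recShift_pow_eq hs hr hW 1 1 (13 - A * a) (1023 - 2 * A * a ^ 3)
      (by rw [hWdef, h1]; push_cast; ring) (by rw [hWdef, h3]; push_cast; ring) k).1
    rw [hWdef] at this
    refine ⟨A * a ^ (2 * k + 1), mul_left_cancel₀ (two_ne_zero (α := ℤ_[2])) ?_⟩
    rw [mul_pow] at this
    linear_combination this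
  · have := (recShift_pow_eq hs hr hW 0 0 (2 - A) (163 - 2 * A * a ^ 2)
      (by rw [hWdef, h0]; push_cast; ring) (by rw [hWdef, h2]; push_cast; ring) k).1
    rw [hWdef] at this
    refine ⟨A * a ^ (2 * k), ?_⟩
    rw [mul_pow] at this
    simp only [add_zero] at this
    linear_combination this

theorem PadicInt.dist_natCast_le_of_modEq {a b N : ℕ} (h : a ≡ b [MOD 2 ^ N]) :
    dist (a : ℤ_[2]) (b : ℤ_[2]) ≤ (1 / 2) ^ N := by
  have hd : (2 : ℤ_[2]) ^ N ∣ (a : ℤ_[2]) - (b : ℤ_[2]) := by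
    have := (pow_p_dvd_int_iff (p := 2) N ((a : ℤ) - b)).mpr
      (by exact_mod_cast (Nat.modEq_iff_dvd.mp h.symm))
    exact_mod_cast this
  have := (norm_le_pow_iff_mem_span_pow ((a : ℤ_[2]) - (b : ℤ_[2])) N).mpr
    (Ideal.mem_span_singleton.mpr (by exact_mod_cast hd))
  rw [dist_eq_norm]
  simpa using this

/-- If `V (i n) - i n / 2` tends to `+∞`, then so does `i n`. -/
theorem tendsto_atTop_of_tendsto_sub_half {V : ℕ → ℕ} {i : ℕ → ℕ}
    (h : Filter.Tendsto (fun n => (V (i n) : ℝ) - (i n : ℝ) / 2) Filter.atTop Filter.atTop) :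
    Filter.Tendsto i Filter.atTop Filter.atTop := by
  refine Filter.tendsto_atTop.mpr fun B => ?_
  filter_upwards [h.eventually_gt_atTop ((∑ j ∈ Finset.range B, V j : ℕ) : ℝ)] with n hn
  by_contra! hlt
  have h1 : V (i n) ≤ ∑ j ∈ Finset.range B, V j :=
    Finset.single_le_sum (f := V) (fun _ _ => Nat.zero_le _) (Finset.mem_range.mpr hlt)
  have h2 : (V (i n) : ℝ) ≤ (∑ j ∈ Finset.range B, V j : ℕ) := by exact_mod_cast h1
  have h3 : (0 : ℝ) ≤ i n := Nat.cast_nonneg _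
  linarith

/-- For the sequence `U 0 = 1, U 1 = 13, U 2 = 163`,
`U (i+3) = 12 U (i+2) + 6 U (i+1) + 12 U i`, there is a unique 2-adic integer `ζ` such
that every sequence `(iₙ)` of naturals with `ν_2(U iₙ) - iₙ/2 → +∞` converges to `ζ`
in `ℤ_2`. -/
theorem stmt13 (U : ℕ → ℕ)
    (h0 : U 0 = 1) (h1 : U 1 = 13) (h2 : U 2 = 163)
    (hrec : ∀ i : ℕ, U (i + 3) = 12 * U (i + 2) + 6 * U (i + 1) + 12 * U i) :
    ∃! ζ : ℤ_[2], ∀ i : ℕ → ℕ,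
      Filter.Tendsto (fun n => (padicValNat 2 (U (i n)) : ℝ) - (i n : ℝ) / 2)
        Filter.atTop Filter.atTop →
      Filter.Tendsto (fun n => ((i n : ℕ) : ℤ_[2])) Filter.atTop (nhds ζ) := by
  obtain ⟨σ, ρ, y, z, hσ, hy1, hy2, hz1, hz2, hU⟩ := exists_eq_recShift_pow h0 h1 h2 hrec
  have hpos : ∀ i, U i ≠ 0 ∧ U (i + 1) ≠ 0 ∧ U (i + 2) ≠ 0 := fun i => by
    induction i with
    | zero => simp [h0, h1, h2]
    | succ i ih => exact ⟨ih.2.1, ih.2.2, by rw [show i + 1 + 2 = i + 3 by ring, hrec]; omega⟩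
  have hy : Even y.1 := even_iff_two_dvd.mpr (dvd_trans ⟨4, by norm_num⟩ hy1)
  choose m hmN hm using exists_two_pow_dvd_recShift_pow (ρ := ρ) hσ hy1 hy2
  have hclose : ∀ N i : ℕ, 2 * (N + 4) ≤ i →
      (N + 4 : ℝ) ≤ (padicValNat 2 (U i) : ℝ) - (i : ℝ) / 2 →
      i ≡ 2 * (4 * m N) + 1 [MOD 2 ^ N] := fun N i hi hv => by
    have hdvd : ∀ j ≤ padicValNat 2 (U i), (2 : ℤ_[2]) ^ j ∣ U i := fun j hj =>
      PadicInt.two_pow_dvd_natCast.mpr ((padicValNat_dvd_iff_le (hpos i).1).mpr hj)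
    obtain ⟨k, rfl | rfl⟩ := Nat.even_or_odd' i
    · exfalso
      have hk : k ≤ padicValNat 2 (U (2 * k)) := by
        have : (k : ℝ) ≤ padicValNat 2 (U (2 * k)) := by push_cast at hv; linarith
        exact_mod_cast this
      have hd : (2 : ℤ_[2]) ^ (k + 1) ∣ 2 * U (2 * k) := by
        rw [pow_succ']
        exact mul_dvd_mul_left _ (hdvd k hk)
      obtain ⟨c, hc⟩ := (dvd_sub_right hd).mp
        ((pow_dvd_pow _ (by omega : k + 1 ≤ 2 * k)).trans (hU k).2)
      rw [pow_succ, mul_assoc] at hc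
      exact PadicInt.not_odd_two_mul c (mul_left_cancel₀ (pow_ne_zero _ two_ne_zero) hc ▸
        (odd_recShift_pow hz1 hz2 k).1)
    · have hk : k + (N + 3) ≤ padicValNat 2 (U (2 * k + 1)) := by
        have : ((k + (N + 3) : ℕ) : ℝ) ≤ padicValNat 2 (U (2 * k + 1)) := by
          push_cast at hv ⊢; linarith
        exact_mod_cast this
      have hd := (dvd_sub_right (hdvd _ hk)).mp
        ((pow_dvd_pow _ (by omega : k + (N + 3) ≤ 2 * k)).trans (hU k).1)
      rw [pow_add, mul_dvd_mul_iff_left (pow_ne_zero _ two_ne_zero)] at hd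
      obtain ⟨j, rfl⟩ := four_dvd_of_eight_dvd_recShift_pow hσ hy1 hy2
        (dvd_trans ⟨2 ^ N, by ring⟩ hd)
      exact (((modEq_of_two_pow_dvd_recShift_pow hσ hy hy2 hd (hm N)).mul_left 4).mul_left
        2).add_right 1
  have hdist : ∀ N M, N ≤ M → dist ((2 * (4 * m N) + 1 : ℕ) : ℤ_[2])
      ((2 * (4 * m M) + 1 : ℕ) : ℤ_[2]) ≤ (1 / 2 : ℝ) ^ N := fun N M h =>
    PadicInt.dist_natCast_le_of_modEq
      ((((modEq_of_two_pow_dvd_recShift_pow hσ hy hy2 (hm N)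
        ((pow_dvd_pow _ (by omega)).trans (hm M))).mul_left 4).mul_left 2).add_right 1)
  have hhalf : Filter.Tendsto (fun N : ℕ => (1 / 2 : ℝ) ^ N) Filter.atTop (nhds 0) :=
    tendsto_pow_atTop_nhds_zero_of_lt_one (by norm_num) (by norm_num)
  obtain ⟨ζ, hζ⟩ := cauchySeq_tendsto_of_complete (cauchySeq_of_le_tendsto_0' _ hdist hhalf)
  refine ⟨ζ, fun i hi => ?_, fun ζ' hζ' => tendsto_nhds_unique (hζ' _ ?_) hζ⟩
  · have hi' := tendsto_atTop_of_tendsto_sub_half (V := fun j => padicValNat 2 (U j)) hi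
    refine Metric.tendsto_atTop'.mpr fun ε hε => ?_
    obtain ⟨N, hN, hN'⟩ := ((hhalf.eventually_lt_const (half_pos hε)).and
      (Metric.tendsto_nhds.mp hζ _ (half_pos hε))).exists
    obtain ⟨n₀, hn₀⟩ := Filter.eventually_atTop.mp ((hi'.eventually_ge_atTop (2 * (N + 4))).and
      (hi.eventually_ge_atTop (N + 4 : ℝ)))
    refine ⟨n₀, fun n hn => ?_⟩
    have h := PadicInt.dist_natCast_le_of_modEq
      (hclose N (i n) (hn₀ n hn.le).1 (hn₀ n hn.le).2)
    linarith [dist_triangle ((i n : ℕ) : ℤ_[2]) ((2 * (4 * m N) + 1 : ℕ) : ℤ_[2]) ζ]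
  · refine Filter.tendsto_atTop_mono (fun N => ?_)
      (Filter.tendsto_atTop_add_const_right _ (-1 / 2 : ℝ) tendsto_natCast_atTop_atTop)
    have hd : (2 : ℤ_[2]) ^ (4 * m N + N) ∣ U (2 * (4 * m N) + 1) := by
      refine (dvd_sub_left ?_).mp ((pow_dvd_pow _ ?_).trans (hU (4 * m N)).1)
      · rw [pow_add]
        exact mul_dvd_mul_left _ ((pow_dvd_pow _ (by omega)).trans (hm N))
      · have := hmN N
        omega
    have hv := (padicValNat_dvd_iff_le (hpos _).1).mp (PadicInt.two_pow_dvd_natCast.mp hd)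
    have hv' : ((4 * m N + N : ℕ) : ℝ) ≤ padicValNat 2 (U (2 * (4 * m N) + 1)) := by
      exact_mod_cast hv
    push_cast at hv' ⊢
    linarith
end

section
/- Let b ≥ 2, u ≥ 1, N ≥ 0 be integers and let U be a numeration system such that U_{i+u} = b·U_i for all i ≥ N. If X ⊆ ℕ is U-recognizable, i.e. the language rep_U(X) is regular, then X is b-recognizable, i.e. the language {rep_b(n) : n ∈ X} is regular, where rep_b(n) is the standard base-b representation of n ≥ 1 (most significant digit first, without leading zeros) and rep_b(0) is the empty word. -/
/-- The standard base-`b` representation of `n` (most significant digit first, no leading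
zeroes); `rep_b 0` is the empty word. -/
def repBase (b n : ℕ) : List ℕ := (Nat.digits b n).reverse

/-- The numerical value of a word in the system with weights `U`, least significant digit first. -/
def lsdVal (U : ℕ → ℕ) (l : List ℕ) : ℕ :=
  ∑ i ∈ Finset.range l.length, l.getD i 0 * U i

theorem valU_eq_lsdVal_reverse (U : ℕ → ℕ) (w : List ℕ) : valU U w = lsdVal U w.reverse := by
  simp [valU, lsdVal]

theorem lsdVal_append (U : ℕ → ℕ) (x y : List ℕ) :
    lsdVal U (x ++ y) = lsdVal U x + lsdVal (fun i => U (x.length + i)) y := by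
  unfold lsdVal
  rw [List.length_append, Finset.sum_range_add]
  congr 1
  · refine Finset.sum_congr rfl fun i hi => ?_
    rw [List.getD_append _ _ _ _ (Finset.mem_range.1 hi)]
  · refine Finset.sum_congr rfl fun i _ => ?_
    rw [List.getD_append_right _ _ _ _ (Nat.le_add_right _ _), Nat.add_sub_cancel_left]

theorem lsdVal_mul (U : ℕ → ℕ) (c : ℕ) (l : List ℕ) :
    lsdVal (fun i => c * U i) l = c * lsdVal U l := by
  simp only [lsdVal, Finset.mul_sum]
  exact Finset.sum_congr rfl fun i _ => by ring

theorem lsdVal_le (U : ℕ → ℕ) {C : ℕ} {l : List ℕ} (h : ∀ a ∈ l, a ≤ C) :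
    lsdVal U l ≤ C * ∑ i ∈ Finset.range l.length, U i := by
  rw [lsdVal, Finset.mul_sum]
  refine Finset.sum_le_sum fun i hi => Nat.mul_le_mul_right _ (h _ ?_)
  rw [List.getD_eq_getElem _ _ (Finset.mem_range.1 hi)]
  exact List.getElem_mem _

theorem IsGreedyRep.digit_le {U : ℕ → ℕ} {w : List ℕ} (hw : IsGreedyRep U w) {C : ℕ}
    (hC : ∀ i, U (i + 1) ≤ C * U i) : ∀ a ∈ w, a ≤ C := by
  intro a ha
  obtain ⟨t, ht, rfl⟩ := List.mem_iff_getElem.1 (List.mem_reverse.2 ha)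
  have h := hw.2 t (by simpa using ht)
  rw [Finset.sum_range_succ, List.getD_eq_getElem _ _ ht] at h
  have h' := (Nat.le_add_left _ _).trans_lt (h.trans_le (hC t))
  exact (Nat.lt_of_mul_lt_mul_right h').le

/-- Greedy expansions padded with leading zeros to a prescribed length. -/
theorem IsNumSys.exists_padded_rep {U : ℕ → ℕ} (hU : IsNumSys U) (k : ℕ) :
    ∀ n < U k, ∃ l : List ℕ, l.length = k ∧ lsdVal U l = n ∧
      ∀ t ≤ k, ∑ i ∈ Finset.range t, l.getD i 0 * U i < U t := by
  induction k with
  | zero =>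
    intro n hn
    rw [hU.base] at hn
    refine ⟨[], rfl, ?_, ?_⟩
    · simp [lsdVal]; omega
    · intro t ht
      obtain rfl : t = 0 := by omega
      simp [hU.base]
  | succ k ih =>
    intro n hn
    have hpos : 0 < U k := by
      have := hU.mono.monotone (Nat.zero_le k)
      rw [hU.base] at this
      omega
    obtain ⟨l, hl, hv, hg⟩ := ih (n % U k) (Nat.mod_lt _ hpos)
    have hval : lsdVal U (l ++ [n / U k]) = n := by
      rw [lsdVal_append, hv]
      simp only [lsdVal, List.length_singleton, Finset.sum_range_one, List.getD_cons_zero, hl,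
        add_zero]
      rw [mul_comm]
      exact Nat.mod_add_div _ _
    refine ⟨l ++ [n / U k], by simp [hl], hval, fun t ht => ?_⟩
    rcases Nat.lt_or_ge k t with h | h
    · obtain rfl : t = k + 1 := by omega
      have hlen : (l ++ [n / U k]).length = k + 1 := by simp [hl]
      rw [lsdVal, hlen] at hval
      omega
    · refine lt_of_eq_of_lt (Finset.sum_congr rfl fun i hi => ?_) (hg t h)
      rw [List.getD_append]
      rw [Finset.mem_range] at hi
      omega

theorem IsNumSys.exists_greedyRep {U : ℕ → ℕ} (hU : IsNumSys U) (n : ℕ) :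
    ∃ w, IsGreedyRep U w ∧ valU U w = n := by
  have hex : ∃ k, n < U k := ⟨n + 1, hU.mono.le_apply (x := n + 1)⟩
  obtain ⟨l, hl, hv, hg⟩ := hU.exists_padded_rep (Nat.find hex) n (Nat.find_spec hex)
  refine ⟨l.reverse, ⟨fun h0 => ?_, fun t ht => ?_⟩, ?_⟩
  · obtain ⟨m, rfl⟩ : ∃ m, l = m ++ [0] := by
      rw [List.head?_reverse, List.getLast?_eq_some_iff] at h0
      exact h0
    have hm : m.length < Nat.find hex := by rw [← hl]; simp
    refine Nat.find_min hex hm ?_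
    have h := hg m.length hm.le
    rw [lsdVal, List.length_append, List.length_singleton, Finset.sum_range_succ] at hv
    simp only [List.getD_append_right _ _ _ _ le_rfl, Nat.sub_self, List.getD_cons_zero,
      zero_mul, add_zero] at hv
    rwa [hv] at h
  · rw [List.reverse_reverse]
    exact hg _ (by simpa [hl] using ht)
  · rw [valU_eq_lsdVal_reverse, List.reverse_reverse, hv]

/-- The language of base-`b` digit words, least significant digit first, of the elements of `A`. -/
def digitsLang (b : ℕ) (A : Set ℕ) : Language ℕ := {w | ∃ n ∈ A, w = Nat.digits b n}

theorem leftQuotient_digitsLang_of_le {b d : ℕ} (hb : 2 ≤ b) (hd : b ≤ d) (A : Set ℕ) :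
    (digitsLang b A).leftQuotient [d] = digitsLang b ∅ := by
  ext v
  constructor
  · rintro ⟨n, -, h⟩
    have : d ∈ Nat.digits b n := by rw [← h]; simp
    exact absurd (Nat.digits_lt_base hb this) (by omega)
  · rintro ⟨n, hn, -⟩
    exact hn.elim

theorem leftQuotient_digitsLang_of_lt {b d : ℕ} (hb : 2 ≤ b) (hd : d < b) (A : Set ℕ) :
    (digitsLang b A).leftQuotient [d] =
      digitsLang b {m | b * m + d ∈ A ∧ (d ≠ 0 ∨ m ≠ 0)} := by
  ext v
  constructor
  · rintro ⟨n, hn, h⟩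
    have hn0 : n ≠ 0 := by
      rintro rfl
      simp at h
    rw [Nat.digits_def' hb (Nat.pos_of_ne_zero hn0)] at h
    obtain ⟨rfl, rfl⟩ : d = n % b ∧ v = Nat.digits b (n / b) := by simpa using h
    refine ⟨n / b, ⟨by rwa [Nat.div_add_mod], ?_⟩, rfl⟩
    by_contra! hc
    have := Nat.div_add_mod n b
    rw [hc.1, hc.2] at this
    omega
  · rintro ⟨m, ⟨hm, hm0⟩, rfl⟩
    refine ⟨b * m + d, hm, ?_⟩
    rw [add_comm, Nat.digits_add b hb d m hd hm0]
    rfl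

/-- A set lying in a finite family closed under `A ↦ {m | b * m + d ∈ A}` has a regular language
of base-`b` representations. -/
theorem isRegular_digitsLang_of_finite_kernel {b : ℕ} (hb : 2 ≤ b) {F : Set (Set ℕ)}
    (hF : F.Finite) (hempty : ∅ ∈ F)
    (hstep : ∀ A ∈ F, ∀ d < b, {m | b * m + d ∈ A} ∈ F) {X : Set ℕ} (hX : X ∈ F) :
    (digitsLang b X).IsRegular := by
  apply Language.IsRegular.of_finite_range_leftQuotient
  refine ((hF.union (hF.image fun A => A \ {0})).image (digitsLang b)).subset ?_
  rintro _ ⟨w, rfl⟩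
  induction w using List.reverseRecOn with
  | nil => exact ⟨X, Or.inl hX, rfl⟩
  | append_singleton w d ih =>
    obtain ⟨A, hA, hw⟩ := ih
    rw [Language.leftQuotient_append, ← hw]
    rcases Nat.lt_or_ge d b with hd | hd
    · rw [leftQuotient_digitsLang_of_lt hb hd]
      refine ⟨_, ?_, rfl⟩
      obtain ⟨B, hB, hAB⟩ : ∃ B ∈ F, ∀ x, x ≠ 0 → (x ∈ A ↔ x ∈ B) := by
        rcases hA with hA | ⟨B, hB, rfl⟩
        · exact ⟨A, hA, fun _ _ => Iff.rfl⟩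
        · exact ⟨B, hB, fun x hx => by simp [hx]⟩
      have key : ∀ m, d ≠ 0 ∨ m ≠ 0 → (b * m + d ∈ A ↔ b * m + d ∈ B) := by
        intro m hm
        refine hAB _ fun h => ?_
        have hbm : b * m = 0 := by omega
        rcases mul_eq_zero.1 hbm with h1 | h1 <;> omega
      by_cases hd0 : d = 0
      · refine Or.inr ⟨_, hstep B hB d hd, ?_⟩
        ext m
        by_cases hm : m = 0
        · simp [hm, hd0]
        · simp [hm, key m (Or.inr hm)]
      · left
        convert hstep B hB d hd using 1
        ext m
        simp [hd0, key m (Or.inl hd0)]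
    · rw [leftQuotient_digitsLang_of_le hb hd]
      exact ⟨∅, Or.inl hempty, rfl⟩

/-- The sets covered by members of `G` that they contain, i.e. the unions of members of `G`. -/
def coveredSets (G : Set (Set ℕ)) : Set (Set ℕ) :=
  {H | ∀ m ∈ H, ∃ B ∈ G, m ∈ B ∧ B ⊆ H}

theorem finite_coveredSets {G : Set (Set ℕ)} (hG : G.Finite) : (coveredSets G).Finite := by
  refine (hG.powerset.image Set.sUnion).subset fun H hH => ?_
  refine ⟨{B ∈ G | B ⊆ H}, fun B hB => hB.1, ?_⟩
  ext m
  constructor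
  · rintro ⟨B, hB, hm⟩
    exact hB.2 hm
  · intro hm
    obtain ⟨B, hB, hmB, hBH⟩ := hH m hm
    exact ⟨B, ⟨hB, hBH⟩, hmB⟩

/-- The values of words with bounded digits in a regular language, for weights that are eventually
multiplied by `b` when the index grows by `u`, form a `b`-recognizable set. -/
theorem isRegular_digitsLang_image_lsdVal {b u N C : ℕ} (hb : 2 ≤ b) {U : ℕ → ℕ}
    (hrec : ∀ i ≥ N, U (i + u) = b * U i) {L : Language ℕ} (hL : L.IsRegular)
    (hC : ∀ w ∈ L, ∀ a ∈ w, a ≤ C) : (digitsLang b (lsdVal U '' L)).IsRegular := by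
  let V : ℕ → ℕ := fun i => U (N + i)
  let K := C * ∑ i ∈ Finset.range (N + u), U i
  let S : Language ℕ × ℕ → Set ℕ := fun p => {n | ∃ v ∈ p.1, lsdVal V v + p.2 = n}
  let G : Set (Set ℕ) := S '' (Set.range L.leftQuotient ×ˢ Set.Iic K) ∪ singleton '' Set.Iic K
  have hG : G.Finite :=
    ((hL.finite_range_leftQuotient.prod (Set.finite_Iic K)).image S).union
      ((Set.finite_Iic K).image _)
  have low_le {y : List ℕ} (hy : ∀ a ∈ y, a ≤ C) (hlen : y.length ≤ N) : lsdVal U y ≤ K := by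
    refine (lsdVal_le U hy).trans (Nat.mul_le_mul_left _ ?_)
    exact Finset.sum_le_sum_of_subset (Finset.range_subset_range.2 (by omega))
  have high_le {y : List ℕ} (hy : ∀ a ∈ y, a ≤ C) (hlen : y.length ≤ u) : lsdVal V y ≤ K := by
    refine (lsdVal_le V hy).trans (Nat.mul_le_mul_left _ ?_)
    calc ∑ i ∈ Finset.range y.length, U (N + i)
        ≤ ∑ i ∈ Finset.range u, U (N + i) :=
          Finset.sum_le_sum_of_subset (Finset.range_subset_range.2 hlen)
      _ ≤ ∑ i ∈ Finset.range (N + u), U i := by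
          rw [Finset.sum_range_add]
          exact Nat.le_add_left _ _
  have kernel_mem : ∀ A ∈ G, ∀ d < b, ∀ m, b * m + d ∈ A →
      ∃ B ∈ G, m ∈ B ∧ B ⊆ {m | b * m + d ∈ A} := by
    have single {m : ℕ} {A : Set ℕ} {d : ℕ} (h : b * m + d ∈ A) (hm : b * m ≤ 2 * K) :
        ∃ B ∈ G, m ∈ B ∧ B ⊆ {m | b * m + d ∈ A} := by
      refine ⟨{m}, Or.inr ⟨m, ?_, rfl⟩, rfl, by simpa using h⟩
      have := Nat.mul_le_mul_right m hb
      simp only [Set.mem_Iic]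
      omega
    rintro A (⟨⟨P, c⟩, ⟨⟨x, rfl⟩, hc⟩, rfl⟩ | ⟨c, hc, rfl⟩) d hd m hm
    · simp only [Set.mem_Iic] at hc
      have hm' := hm
      obtain ⟨v, hv, hvm⟩ := hm'
      simp only at hvm hv
      have hvC : ∀ a ∈ v, a ≤ C := fun a ha => hC _ hv a (List.mem_append_right _ ha)
      rcases Nat.lt_or_ge v.length u with hlen | hlen
      · refine single hm ?_
        have := high_le hvC hlen.le
        omega
      · obtain ⟨y, z, rfl, hy⟩ : ∃ y z, v = y ++ z ∧ y.length = u :=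
          ⟨v.take u, v.drop u, (List.take_append_drop u v).symm, by simpa using hlen⟩
        have hyK : lsdVal V y ≤ K :=
          high_le (fun a ha => hvC a (List.mem_append_left _ ha)) hy.le
        have split (z : List ℕ) : lsdVal V (y ++ z) = lsdVal V y + b * lsdVal V z := by
          rw [lsdVal_append, ← lsdVal_mul]
          congr 2
          ext i
          change U (N + (y.length + i)) = b * U (N + i)
          rw [← hrec _ (Nat.le_add_right _ _), hy]
          congr 1
          omega
        rw [split] at hvm
        have hzm : lsdVal V z ≤ m := by
          by_contra! h
          have := Nat.mul_le_mul_left b (Nat.succ_le_of_lt h)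
          rw [Nat.mul_succ] at this
          omega
        obtain ⟨e, rfl⟩ := Nat.exists_eq_add_of_le hzm
        rw [mul_add] at hvm
        refine ⟨S (L.leftQuotient (x ++ y), e), Or.inl ⟨_, ⟨⟨_, rfl⟩, ?_⟩, rfl⟩, ⟨z, ?_, rfl⟩, ?_⟩
        · have := Nat.mul_le_mul_right e hb
          simp only [Set.mem_Iic]
          omega
        · simpa using hv
        · rintro _ ⟨z', hz', rfl⟩
          refine ⟨y ++ z', by simpa using hz', ?_⟩
          simp only
          rw [split, mul_add]
          omega
    · refine single hm ?_
      simp only [Set.mem_singleton_iff, Set.mem_Iic] at hm hc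
      omega
  refine isRegular_digitsLang_of_finite_kernel hb (finite_coveredSets hG) (fun m hm => hm.elim)
    (fun A hA d hd m hm => ?_) ?_
  · obtain ⟨B, hB, hmB, hBA⟩ := hA _ hm
    obtain ⟨B', hB', hmB', hBB'⟩ := kernel_mem B hB d hd m hmB
    exact ⟨B', hB', hmB', fun x hx => hBA (hBB' hx)⟩
  · rintro _ ⟨w, hw, rfl⟩
    rcases Nat.lt_or_ge w.length N with hlen | hlen
    · refine ⟨{lsdVal U w}, Or.inr ⟨_, low_le (hC w hw) hlen.le, rfl⟩, rfl, ?_⟩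
      simpa using ⟨w, hw, rfl⟩
    · obtain ⟨x, v, rfl, hx⟩ : ∃ x v, w = x ++ v ∧ x.length = N :=
        ⟨w.take N, w.drop N, (List.take_append_drop N w).symm, by simpa using hlen⟩
      have split (v : List ℕ) : lsdVal U (x ++ v) = lsdVal V v + lsdVal U x := by
        rw [lsdVal_append, hx, add_comm]
      have hxK : lsdVal U x ≤ K :=
        low_le (fun a ha => hC _ hw a (List.mem_append_left _ ha)) hx.le
      refine ⟨S (L.leftQuotient x, lsdVal U x), Or.inl ⟨_, ⟨⟨x, rfl⟩, Set.mem_Iic.2 hxK⟩, rfl⟩,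
        ⟨v, hw, (split v).symm⟩, ?_⟩
      rintro _ ⟨v', hv', rfl⟩
      exact ⟨x ++ v', hv', split v'⟩

/-- If `U` is a numeration system with `U (i+u) = b * U i` for all
`i ≥ N`, then every `U`-recognizable set is `b`-recognizable. -/
theorem stmt14 (b u N : ℕ) (hb : 2 ≤ b) (hu : 1 ≤ u)
    (U : ℕ → ℕ) (hU : IsNumSys U)
    (hrec : ∀ i ≥ N, U (i + u) = b * U i)
    (X : Set ℕ) (hX : IsRegularLang (repLang U X)) :
    IsRegularLang {w : List ℕ | ∃ n ∈ X, w = repBase b n} := by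
  obtain ⟨C, hC⟩ := hU.ratio
  have hL : (repLang U X).reverse.IsRegular := Language.IsRegular.reverse hX
  have hdig : ∀ w ∈ (repLang U X).reverse, ∀ a ∈ w, a ≤ C := fun w hw a ha =>
    IsGreedyRep.digit_le (show _ ∧ _ from hw).1 hC a (List.mem_reverse.2 ha)
  have hval : lsdVal U '' (repLang U X).reverse = X := by
    ext n
    constructor
    · rintro ⟨w, hw, rfl⟩
      have := (show _ ∧ _ from hw).2
      rwa [valU_eq_lsdVal_reverse, List.reverse_reverse] at this
    · intro hn
      obtain ⟨w, hw, rfl⟩ := hU.exists_greedyRep n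
      refine ⟨w.reverse, ?_, (valU_eq_lsdVal_reverse U w).symm⟩
      exact Language.reverse_mem_reverse.2 ⟨hw, hn⟩
  have hreg := (isRegular_digitsLang_image_lsdVal hb hrec hL hdig).reverse
  rw [hval] at hreg
  suffices h : {w : List ℕ | ∃ n ∈ X, w = repBase b n} = (digitsLang b X).reverse from
    h ▸ hreg
  ext w
  constructor
  · rintro ⟨n, hn, rfl⟩
    exact ⟨n, hn, List.reverse_reverse _⟩
  · rintro ⟨n, hn, h⟩
    exact ⟨n, hn, List.reverse_eq_iff.1 h⟩
end
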